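/- arXiv:2302.03346 — 3 statements merged into one kernel-verified Lean document; each statement's English description precedes it below -/
import Mathlib

section
/- Let G be a finitely generated elementary amenable group. If G is indicably coherent, then G is virtually soluble. -/
universe u v

/-- Elementary amenable groups: the smallest class (within a universe) containing all finite
and all abelian groups that is closed under group extensions, directed unions, and
isomorphisms. -/
inductive ElementaryAmenable : ∀ (G : Type u) [Group G], Prop
  | of_finite (G : Type u) [Group G] (h : Finite G) : ElementaryAmenable G
  | of_comm (G : Type u) [Group G] (h : ∀ a b : G, a * b = b * a) : ElementaryAmenable G
  | of_mulEquiv (G H : Type u) [Group G] [Group H] (e : G ≃* H)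
      (h : ElementaryAmenable G) : ElementaryAmenable H
  | of_extension (G : Type u) [Group G] (N : Subgroup G) (hN : N.Normal)
      (h1 : ElementaryAmenable N) (h2 : ElementaryAmenable (G ⧸ N)) : ElementaryAmenable G
  | of_directedUnion (G : Type u) [Group G] (ι : Type u) (S : ι → Subgroup G)
      (hdir : Directed (· ≤ ·) S) (hcov : ∀ g : G, ∃ i, g ∈ S i)
      (h : ∀ i, ElementaryAmenable (S i)) : ElementaryAmenable G
/-- `H` splits as an HNN extension with vertex group `V` realising the epimorphism
`φ : H → ℤ`: there are an edge subgroup `C` of `V`, an isomorphism `ψ` of `C` onto another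
subgroup `D` of `V`, and an isomorphism of the corresponding abstract HNN extension with `H`
restricting to the inclusion of `V`, such that `φ` coincides with the quotient map dividing
`H` by the normal closure of `V` (i.e. `φ` kills `V` and sends the stable letter to `1 ∈ ℤ`). -/
def SplitsAsHNNRealising (H : Type u) [Group H] (φ : H →* Multiplicative ℤ)
    (V : Subgroup H) : Prop :=
  ∃ (C D : Subgroup V) (ψ : C ≃* D) (e : HNNExtension V C D ψ ≃* H),
    (∀ v : V, e (HNNExtension.of v) = (v : H)) ∧
    (∀ v ∈ V, φ v = 1) ∧
    φ (e HNNExtension.t) = Multiplicative.ofAdd 1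
/-- A group `G` is indicably coherent if for every finitely generated subgroup `H ≤ G` and
every epimorphism `φ : H → ℤ`, the group `H` splits as an HNN extension with finitely
generated vertex group realising `φ`. -/
def IndicablyCoherent (G : Type u) [Group G] : Prop :=
  ∀ H : Subgroup G, Group.FG H → ∀ φ : H →* Multiplicative ℤ, Function.Surjective φ →
    ∃ A : Subgroup H, Group.FG A ∧ SplitsAsHNNRealising H φ A

namespace IC

/-- No nonabelian free subgroup. -/
def NoF2 (G : Type*) [Group G] : Prop :=
  ∀ f : FreeGroup Bool →* G, ¬ Function.Injective f

theorem NoF2.of_injective {G H : Type*} [Group G] [Group H] (h : NoF2 H) (g : G →* H)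
    (hg : Function.Injective g) : NoF2 G :=
  fun f hf => h (g.comp f) (hg.comp hf)

theorem isCyclic_of_comm {α : Type*} (M : Subgroup (FreeGroup α))
    (hM : ∀ x ∈ M, ∀ y ∈ M, x * y = y * x) : IsCyclic M := by
  classical
  have e := IsFreeGroup.toFreeGroup M
  have hs : Subsingleton (IsFreeGroup.Generators M) := by
    constructor
    intro x y
    have h : (FreeGroup.of x) * (FreeGroup.of y) = FreeGroup.of y * FreeGroup.of x := by
      apply e.symm.injective
      rw [map_mul, map_mul]
      exact Subtype.ext (hM _ (e.symm _).2 _ (e.symm _).2)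
    by_contra hne
    have h2 := congrArg FreeGroup.toWord h
    simp [FreeGroup.toWord_mul, FreeGroup.toWord_of, FreeGroup.reduce, hne, Ne.symm hne] at h2
  rw [e.isCyclic]
  rcases isEmpty_or_nonempty (IsFreeGroup.Generators M) with he | ⟨⟨x⟩⟩
  · infer_instance
  · have : Unique (IsFreeGroup.Generators M) := ⟨⟨x⟩, fun y => Subsingleton.elim _ _⟩
    rw [(FreeGroup.mulEquivIntOfUnique (α := IsFreeGroup.Generators M)).isCyclic]
    infer_instance

theorem exists_root {α : Type*} (x y : FreeGroup α) (h : x * y = y * x) :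
    ∃ (z : FreeGroup α) (i j : ℤ), z ^ i = x ∧ z ^ j = y := by
  have hc := Subgroup.isMulCommutative_closure (k := {x, y}) (by
    rintro a (rfl | rfl) b (rfl | rfl) <;> simp [h])
  have := isCyclic_of_comm (Subgroup.closure {x, y}) (fun a ha b hb => by
    have := hc.is_comm.comm ⟨a, ha⟩ ⟨b, hb⟩
    exact congrArg Subtype.val this)
  obtain ⟨z, hz⟩ := this.exists_generator
  obtain ⟨i, hi⟩ := hz ⟨x, Subgroup.subset_closure (by simp)⟩
  obtain ⟨j, hj⟩ := hz ⟨y, Subgroup.subset_closure (by simp)⟩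
  exact ⟨z, i, j, by simpa using congrArg Subtype.val hi, by simpa using congrArg Subtype.val hj⟩

theorem not_comm_of_normal (M : Subgroup (FreeGroup Bool)) [hn : M.Normal] (hM : M ≠ ⊥) :
    ¬ (∀ x ∈ M, ∀ y ∈ M, x * y = y * x) := by
  intro hc
  obtain ⟨⟨w, hwM⟩, hw⟩ := (isCyclic_of_comm M hc).exists_generator
  have hgen : ∀ x ∈ M, ∃ k : ℤ, w ^ k = x := by
    intro x hx
    obtain ⟨k, hk⟩ := hw ⟨x, hx⟩
    exact ⟨k, by simpa using congrArg Subtype.val hk⟩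
  have hw1 : w ≠ 1 := by
    rintro rfl
    apply hM
    rw [Subgroup.eq_bot_iff_forall]
    intro x hx
    obtain ⟨k, hk⟩ := hgen x hx
    simpa using hk.symm
  have key : ∀ g : FreeGroup Bool, (g ^ 2) * w = w * g ^ 2 := by
    intro g
    obtain ⟨k, hk⟩ := hgen _ (hn.conj_mem w hwM g)
    obtain ⟨l, hl⟩ := hgen _ (hn.conj_mem w hwM g⁻¹)
    have h1 : w ^ (k * l) = w ^ (1 : ℤ) := by
      rw [zpow_mul, hk, conj_zpow, hl]; group
    have h2 : k * l = 1 := by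
      have h5 : w ^ (k * l - 1) = 1 := by rw [zpow_sub, h1, mul_inv_cancel]
      have := (IsMulTorsionFree.zpow_eq_one_iff_right hw1).1 h5
      lia
    have h3 : k * k = 1 := by
      rcases Int.eq_one_or_neg_one_of_mul_eq_one h2 with rfl | rfl <;> rfl
    have h4 : g ^ 2 * w * (g ^ 2)⁻¹ = w := by
      calc g ^ 2 * w * (g ^ 2)⁻¹ = g * (g * w * g⁻¹) * g⁻¹ := by rw [pow_two]; group
        _ = w ^ (k * k) := by rw [← hk, ← conj_zpow, ← hk, zpow_mul]
        _ = w := by rw [h3, zpow_one]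
    rw [mul_inv_eq_iff_eq_mul] at h4
    exact h4
  have key2 : ∀ b : Bool, ∃ i j : ℤ, i ≠ 0 ∧ j ≠ 0 ∧ w ^ i = (FreeGroup.of b) ^ (2 * j) := by
    intro b
    obtain ⟨z, i, j, hi, hj⟩ := exists_root _ _ (key (FreeGroup.of b))
    refine ⟨i, j, ?_, ?_, ?_⟩
    · rintro rfl
      let f : FreeGroup Bool →* Multiplicative ℤ := FreeGroup.lift fun _ => Multiplicative.ofAdd 1
      have := congrArg f hi
      simp [f] at this
      exact absurd this.symm (by decide)
    · rintro rfl
      exact hw1 (by simpa using hj.symm)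
    · rw [← hj, ← zpow_mul, mul_comm, zpow_mul, hi, zpow_mul]; simp
  obtain ⟨i, j, hi, hj, h⟩ := key2 true
  obtain ⟨i', j', hi', hj', h'⟩ := key2 false
  have h3 : (FreeGroup.of true) ^ (2 * j * i') = (FreeGroup.of false) ^ (2 * j' * i) := by
    rw [zpow_mul, ← h, zpow_mul, ← h', ← zpow_mul, ← zpow_mul, mul_comm]
  let f : FreeGroup Bool →* Multiplicative ℤ :=
    FreeGroup.lift fun b => if b then Multiplicative.ofAdd 1 else 1
  have h4 := congrArg f h3
  simp [f, ← ofAdd_zsmul] at h4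
  rcases h4 with h4 | h4
  · exact hj h4
  · exact hi' h4

theorem exists_free_of_not_comm (M : Subgroup (FreeGroup Bool))
    (hM : ¬ (∀ x ∈ M, ∀ y ∈ M, x * y = y * x)) : ¬ NoF2 M := by
  have e := IsFreeGroup.toFreeGroup M
  have : ∃ x y : IsFreeGroup.Generators M, x ≠ y := by
    by_contra hcon
    push Not at hcon
    have : Subsingleton (IsFreeGroup.Generators M) := ⟨hcon⟩
    apply hM
    have hcyc : IsCyclic M := by
      rw [e.isCyclic]
      rcases isEmpty_or_nonempty (IsFreeGroup.Generators M) with he | ⟨⟨x⟩⟩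
      · infer_instance
      · have : Unique (IsFreeGroup.Generators M) := ⟨⟨x⟩, fun y => Subsingleton.elim _ _⟩
        rw [(FreeGroup.mulEquivIntOfUnique (α := IsFreeGroup.Generators M)).isCyclic]
        infer_instance
    intro x hx y hy
    let _ := IsCyclic.commGroup (α := M)
    exact congrArg Subtype.val (mul_comm (⟨x, hx⟩ : M) ⟨y, hy⟩)
  obtain ⟨x, y, hxy⟩ := this
  intro h
  refine h (e.symm.toMonoidHom.comp (FreeGroup.map (fun b : Bool => if b then x else y))) ?_
  apply e.symm.injective.comp
  apply FreeGroup.map_injective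
  rintro (_ | _) (_ | _) <;> simp [hxy, Ne.symm hxy]

theorem noF2_of_EA (G : Type u) [Group G] (h : ElementaryAmenable G) : NoF2 G := by
  induction h with
  | of_finite G h =>
    intro f hf
    have := Finite.of_injective f hf
    exact not_finite (FreeGroup Bool)
  | of_comm G h =>
    intro f hf
    have := hf ((map_mul f (FreeGroup.of true) (FreeGroup.of false)).trans
      ((h _ _).trans (map_mul f _ _).symm))
    exact absurd (congrArg FreeGroup.toWord this) (by decide)
  | of_mulEquiv G H e h ih => exact ih.of_injective e.symm.toMonoidHom e.symm.injective
  | of_extension G N hN h1 h2 ih1 ih2 =>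
    intro f hf
    by_cases hM : N.comap f = ⊥
    · apply ih2 ((QuotientGroup.mk' N).comp f)
      rw [← MonoidHom.ker_eq_bot_iff, ← MonoidHom.comap_ker, QuotientGroup.ker_mk', hM]
    · refine exists_free_of_not_comm _ (not_comm_of_normal _ hM) ?_
      refine ih1.of_injective (f.subgroupComap N) ?_
      intro x y hxy
      exact Subtype.ext (hf (congrArg Subtype.val hxy))
  | of_directedUnion G ι S hdir hcov h ih =>
    intro f hf
    obtain ⟨i, hi⟩ := hcov (f (FreeGroup.of true))
    obtain ⟨j, hj⟩ := hcov (f (FreeGroup.of false))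
    obtain ⟨k, hk1, hk2⟩ := hdir i j
    have hr : ∀ x, f x ∈ S k := by
      intro x
      induction x using FreeGroup.induction_on with
      | C1 => simp
      | of b => cases b; exacts [hk2 hj, hk1 hi]
      | inv_of b hb => simpa using hb
      | mul x y hx hy => rw [map_mul]; exact mul_mem hx hy
    refine ih k (f.codRestrict (S k) hr) ?_
    intro x y hxy
    exact hf (congrArg Subtype.val hxy)


section HNN
open HNNExtension

variable {V : Type*} [Group V] {C D : Subgroup V}

/-- left part of a letter -/
def pre (a b : V) : Bool × Bool → V
  | (true, _) => 1
  | (false, true) => b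
  | (false, false) => a⁻¹

/-- right part of a letter -/
def post (a b : V) : Bool × Bool → V
  | (true, _) => 1
  | (false, true) => a
  | (false, false) => b⁻¹

/-- sign of a letter -/
def sgn (s : Bool) : ℤˣ := if s then 1 else -1

/-- the HNN word of a free group word -/
def wrd (a b : V) : List (Bool × Bool) → V × List (ℤˣ × V)
  | [] => (1, [])
  | s :: r => (pre a b s, (sgn s.2, post a b s * (wrd a b r).1) :: (wrd a b r).2)

theorem wrd_chain (a b : V) (ha : a ∉ C) (hb : b ∉ D) (L : List (Bool × Bool))
    (hL : FreeGroup.IsReduced L) :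
    (wrd a b L).2.IsChain (fun x y => x.2 ∈ toSubgroup C D x.1 → x.1 = y.1) := by
  induction L with
  | nil => simp [wrd]
  | cons s r ih =>
    cases r with
    | nil => simp [wrd]
    | cons s' r =>
      have h := List.isChain_cons_cons.1 hL
      have ih' := ih h.2
      simp only [wrd] at ih' ⊢
      rw [List.isChain_cons_cons]
      refine ⟨?_, ih'⟩
      have h1 := h.1
      obtain ⟨_ | _, _ | _⟩ := s <;> obtain ⟨_ | _, _ | _⟩ := s' <;>
        simp_all [sgn, pre, post]

theorem wrd_prod {ψ : C ≃* D} (a b : V) (L : List (Bool × Bool)) :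
    (of (wrd a b L).1 * ((wrd a b L).2.map (fun x => t ^ (x.1 : ℤ) * of x.2)).prod :
      HNNExtension V C D ψ) =
    FreeGroup.lift (fun g : Bool => if g then t else of b * t * of a) (FreeGroup.mk L) := by
  induction L with
  | nil => simp [wrd]
  | cons s r ih =>
    rw [FreeGroup.lift_mk] at ih ⊢
    simp only [wrd, List.map_cons, List.prod_cons, map_mul] at ih ⊢
    rw [← ih]
    obtain ⟨_ | _, _ | _⟩ := s <;> simp [sgn, pre, post, mul_assoc]

theorem hnn_ascending {ψ : C ≃* D} (h : NoF2 (HNNExtension V C D ψ)) : C = ⊤ ∨ D = ⊤ := by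
  by_contra hcon
  push Not at hcon
  obtain ⟨a, ha⟩ : ∃ a, a ∉ C := by
    by_contra hc; push Not at hc; exact hcon.1 ((Subgroup.eq_top_iff' C).2 hc)
  obtain ⟨b, hb⟩ : ∃ a, a ∉ D := by
    by_contra hc; push Not at hc; exact hcon.2 ((Subgroup.eq_top_iff' D).2 hc)
  refine h (FreeGroup.lift (fun g : Bool => if g then t else of b * t * of a)) ?_
  rw [injective_iff_map_eq_one]
  intro x hx
  have hp := wrd_prod (ψ := ψ) a b x.toWord
  rw [FreeGroup.mk_toWord, hx] at hp
  let w : HNNExtension.NormalWord.ReducedWord V C D :=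
    ⟨(wrd a b x.toWord).1, (wrd a b x.toWord).2, wrd_chain a b ha hb _ FreeGroup.isReduced_toWord⟩
  have hw := HNNExtension.ReducedWord.toList_eq_nil_of_mem_of_range ψ w
    (by rw [show w.prod ψ = 1 from hp]; exact one_mem _)
  have hw' : (wrd a b x.toWord).2 = [] := hw
  rw [← FreeGroup.toWord_eq_nil_iff]
  cases hx' : x.toWord with
  | nil => rfl
  | cons s r => rw [hx'] at hw'; simp [wrd] at hw'

end HNN


/-- virtually solvable -/
def VS (G : Type*) [Group G] : Prop := ∃ H : Subgroup G, H.FiniteIndex ∧ Group.IsSolvable H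

theorem solvable_of_le {G : Type*} [Group G] {H K : Subgroup G} (h : H ≤ K)
    (hK : Group.IsSolvable K) : Group.IsSolvable H :=
  Group.isSolvable_of_isSolvable_injective (Subgroup.inclusion_injective h)

theorem solvable_sup {G : Type*} [Group G] (H N : Subgroup G) [N.Normal]
    (hH : Group.IsSolvable H) (hN : Group.IsSolvable N) :
    Group.IsSolvable (H ⊔ N : Subgroup G) := by
  have h1 : Group.IsSolvable (_ ⧸ N.subgroupOf (H ⊔ N)) :=
    Group.isSolvable_of_surjective (f := (QuotientGroup.quotientInfEquivProdNormalQuotient H N).toMonoidHom)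
      (QuotientGroup.quotientInfEquivProdNormalQuotient H N).surjective
  refine Group.isSolvable_of_ker_le_range (Subgroup.inclusion (le_sup_right : N ≤ H ⊔ N))
    (QuotientGroup.mk' (N.subgroupOf (H ⊔ N))) ?_
  rw [QuotientGroup.ker_mk', Subgroup.inclusion_range]

theorem exists_radical {A : Type*} [Group A] (h : VS A) :
    ∃ S : Subgroup A, S.Normal ∧ S.FiniteIndex ∧ Group.IsSolvable S ∧
      ∀ N : Subgroup A, N.Normal → Group.IsSolvable N → N ≤ S := by
  classical
  have hex : ∃ n : ℕ, ∃ S : Subgroup A, S.Normal ∧ S.FiniteIndex ∧ Group.IsSolvable S ∧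
      S.index = n := by
    obtain ⟨H, hf, hs⟩ := h
    exact ⟨_, H.normalCore, inferInstance, inferInstance,
      solvable_of_le H.normalCore_le hs, rfl⟩
  obtain ⟨S, hSn, hSf, hSs, hSi⟩ := Nat.find_spec hex
  refine ⟨S, hSn, hSf, hSs, fun N hN hNs => ?_⟩
  by_contra hle
  have hlt : S < S ⊔ N := lt_of_le_of_ne le_sup_left (fun h => hle (h ▸ le_sup_right))
  have h1 := Subgroup.index_strictAnti hlt
  rw [hSi] at h1
  exact Nat.find_min hex h1 ⟨S ⊔ N, inferInstance, Subgroup.finiteIndex_of_le hlt.le,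
    solvable_sup S N hSs hNs, rfl⟩

theorem radical_endo {A : Type*} [Group A] (S : Subgroup A) (hSn : S.Normal) (hSf : S.FiniteIndex)
    (hSs : Group.IsSolvable S) (hmax : ∀ N : Subgroup A, N.Normal → Group.IsSolvable N → N ≤ S)
    (α : A →* A) (hα : Function.Injective α) :
    S.comap α = S ∧ ∀ a : A, ∃ a' : A, ∃ s ∈ S, a = α a' * s := by
  have hle : S.comap α ≤ S := by
    refine hmax _ inferInstance ?_
    refine Group.isSolvable_of_isSolvable_injective (f := α.subgroupComap S) ?_
    intro x y hxy
    exact Subtype.ext (hα (congrArg Subtype.val hxy))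
  have hi : (S.comap α).index = S.relIndex (α.range ⊔ S) := by
    rw [Subgroup.index_comap, Subgroup.relIndex_sup_right]
  have hm : S.relIndex (α.range ⊔ S) * (α.range ⊔ S).index = S.index :=
    Subgroup.relIndex_mul_index le_sup_right
  have h0 : S.index ≠ 0 := hSf.index_ne_zero
  have hfi : (S.comap α).FiniteIndex := ⟨by
    rw [hi]; intro h; rw [h, zero_mul] at hm; exact h0 hm.symm⟩
  have heq : S.comap α = S := by
    by_contra hne
    have hlt := Subgroup.index_strictAnti (lt_of_le_of_ne hle hne)
    have : (S.comap α).index ≤ S.index := by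
      rw [hi]; exact Nat.le_of_dvd (Nat.pos_of_ne_zero h0) ⟨_, hm.symm⟩
    lia
  refine ⟨heq, fun a => ?_⟩
  rw [← hi, heq] at hm
  have htop : α.range ⊔ S = ⊤ := by
    rw [← Subgroup.index_eq_one]
    exact Nat.eq_of_mul_eq_mul_left (Nat.pos_of_ne_zero h0) (by rw [hm, mul_one])
  have ha : a ∈ α.range ⊔ S := htop ▸ Subgroup.mem_top a
  obtain ⟨_, ⟨a', rfl⟩, s, hs, h⟩ := Subgroup.mem_sup_of_normal_right.1 ha
  exact ⟨a', s, hs, h.symm⟩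

theorem derived_union {K : Type*} [Group K] (P : ℕ → Subgroup K) (hP : Monotone P)
    (hcov : ∀ x, ∃ n, x ∈ P n) (k : ℕ) :
    ∀ x ∈ derivedSeries K k, ∃ n, x ∈ (derivedSeries (P n) k).map (P n).subtype := by
  have hmono : ∀ k, Monotone fun n => (derivedSeries (P n) k).map (P n).subtype := by
    intro k m n hmn
    have h1 := map_derivedSeries_le_derivedSeries (Subgroup.inclusion (hP hmn)) k
    have h2 := Subgroup.map_mono (f := (P n).subtype) h1
    rw [Subgroup.map_map] at h2
    exact h2
  have hdir : ∀ k, Directed (· ≤ ·) fun n => (derivedSeries (P n) k).map (P n).subtype :=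
    fun k => (hmono k).directed_le
  suffices h : derivedSeries K k ≤ ⨆ n, (derivedSeries (P n) k).map (P n).subtype by
    intro x hx
    exact (Subgroup.mem_iSup_of_directed (hdir k)).1 (h hx)
  induction k with
  | zero =>
    intro x _
    obtain ⟨n, hn⟩ := hcov x
    exact Subgroup.mem_iSup_of_mem n ⟨⟨x, hn⟩, by simp, rfl⟩
  | succ k ih =>
    rw [derivedSeries_succ, Subgroup.commutator_le]
    intro x hx y hy
    obtain ⟨m, hm⟩ := (Subgroup.mem_iSup_of_directed (hdir k)).1 (ih hx)
    obtain ⟨n, hn⟩ := (Subgroup.mem_iSup_of_directed (hdir k)).1 (ih hy)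
    have hm' := hmono k (le_max_left m n) hm
    have hn' := hmono k (le_max_right m n) hn
    refine Subgroup.mem_iSup_of_mem (max m n) ?_
    rw [derivedSeries_succ, Subgroup.map_commutator]
    exact Subgroup.commutator_mem_commutator hm' hn'

theorem derived_injective {G H : Type*} [Group G] [Group H] (f : G →* H)
    (hf : Function.Injective f) (d : ℕ) (h : derivedSeries H d = ⊥) : derivedSeries G d = ⊥ := by
  have := map_derivedSeries_le_derivedSeries f d
  rw [h, le_bot_iff] at this
  exact (Subgroup.map_eq_bot_iff_of_injective _ hf).1 this

section Asc
variable {E : Type*} [Group E]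

theorem conj_pow_mem {S : Subgroup E} {t : E} (hS : ∀ s ∈ S, t * s * t⁻¹ ∈ S) (k : ℕ) :
    ∀ s ∈ S, t ^ k * s * (t ^ k)⁻¹ ∈ S := by
  induction k with
  | zero => simp
  | succ k ih =>
    intro s hs
    have := hS _ (ih s hs)
    rw [pow_succ']
    simpa [mul_assoc] using this

/-- the ascending hull -/
def hull (S : Subgroup E) (t : E) (hS : ∀ s ∈ S, t * s * t⁻¹ ∈ S) : Subgroup E where
  carrier := {x | ∃ n m : ℕ, t ^ n * x * (t ^ m)⁻¹ ∈ S}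
  one_mem' := ⟨0, 0, by simp⟩
  mul_mem' := by
    rintro x y ⟨n, m, h⟩ ⟨n', m', h'⟩
    refine ⟨n' + n, m + m', ?_⟩
    have := S.mul_mem (conj_pow_mem hS n' _ h) (conj_pow_mem hS m _ h')
    convert this using 1
    have e : t ^ n' * t ^ m = t ^ m * t ^ n' := by rw [← pow_add, ← pow_add, add_comm]
    have e2 : (t ^ m)⁻¹ * (t ^ n')⁻¹ * (t ^ m * t ^ n') = 1 := by
      rw [← e]; group
    calc t ^ (n' + n) * (x * y) * (t ^ (m + m'))⁻¹
        = t ^ n' * t ^ n * x * 1 * y * (t ^ m')⁻¹ * (t ^ m)⁻¹ := by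
          rw [pow_add, pow_add]; group
      _ = _ := by rw [← e2]; simp only [mul_assoc]
  inv_mem' := by
    rintro x ⟨n, m, h⟩
    refine ⟨m, n, ?_⟩
    have := S.inv_mem h
    simpa [mul_assoc] using this

theorem asc (A : Subgroup E) (t : E) (φ : E →* Multiplicative ℤ) (hφA : ∀ a ∈ A, φ a = 1)
    (hφt : φ t ≠ 1) (hA : ∀ a ∈ A, t * a * t⁻¹ ∈ A)
    (hgen : ∀ T : Subgroup E, A ≤ T → t ∈ T → T = ⊤) (hVS : VS A) : VS E := by
  obtain ⟨S, hSn, hSf, hSs, hmax⟩ := exists_radical hVS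
  let α : A →* A :=
    { toFun := fun a => ⟨t * a * t⁻¹, hA _ a.2⟩
      map_one' := by ext; simp
      map_mul' := fun a b => by ext; simp }
  have hα : Function.Injective α := by
    intro a b hab
    have := congrArg Subtype.val hab
    ext
    simpa [α] using this
  obtain ⟨hc, hprod⟩ := radical_endo S hSn hSf hSs hmax α hα
  let S1 : Subgroup E := S.map A.subtype
  have hS1s : Group.IsSolvable S1 :=
    Group.isSolvable_of_surjective (f := A.subtype.subgroupMap S)
      (A.subtype.subgroupMap_surjective S)
  have hS1A : S1 ≤ A := by rintro _ ⟨s, -, rfl⟩; exact s.2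
  have hS1 : ∀ s ∈ S1, t * s * t⁻¹ ∈ S1 := by
    rintro _ ⟨s, hs, rfl⟩
    have hs' : s ∈ S.comap α := by rw [hc]; exact hs
    exact ⟨α s, hs', rfl⟩
  have hprod1 : ∀ a ∈ A, ∃ a' ∈ A, ∃ s ∈ S1, a = t * a' * t⁻¹ * s := by
    intro a ha
    obtain ⟨a', s, hs, h⟩ := hprod ⟨a, ha⟩
    exact ⟨a', a'.2, s, ⟨s, hs, rfl⟩, congrArg Subtype.val h⟩
  have hprodn : ∀ n : ℕ, ∀ a ∈ A, ∃ a' ∈ A, ∃ s ∈ S1, a = t ^ n * a' * (t ^ n)⁻¹ * s := by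
    intro n
    induction n with
    | zero => intro a ha; exact ⟨a, ha, 1, one_mem _, by simp⟩
    | succ n ih =>
      intro a ha
      obtain ⟨a', ha', s, hs, rfl⟩ := ih a ha
      obtain ⟨a'', ha'', s', hs', rfl⟩ := hprod1 a' ha'
      refine ⟨a'', ha'', _, mul_mem (conj_pow_mem hS1 n s' hs') hs, ?_⟩
      rw [pow_succ]; group
  let T := hull S1 t hS1
  have hS1T : S1 ≤ T := fun s hs => ⟨0, 0, by simpa using hs⟩
  have htop : hull A t hA = ⊤ :=
    hgen _ (fun s hs => ⟨0, 0, by simpa using hs⟩) ⟨0, 1, by simp⟩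
  have hcover : ∀ x : E, ∃ a ∈ A, a⁻¹ * x ∈ T := by
    intro x
    have hx : x ∈ hull A t hA := htop ▸ Subgroup.mem_top x
    obtain ⟨n, m, h⟩ := hx
    obtain ⟨a, ha, s, hs, h'⟩ := hprodn n _ h
    refine ⟨a, ha, n, m, ?_⟩
    convert hs using 1
    have : x = (t ^ n)⁻¹ * (t ^ n * a * (t ^ n)⁻¹ * s) * t ^ m := by rw [← h']; group
    rw [this]; group
  refine ⟨T, ?_, ?_⟩
  · have hfin : Finite (A ⧸ S) := Subgroup.finite_quotient_of_finiteIndex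
    have : Finite (E ⧸ T) := by
      refine Finite.of_surjective (fun q : A ⧸ S => (QuotientGroup.mk (q.out : E) : E ⧸ T)) ?_
      intro x
      induction x using QuotientGroup.induction_on with
      | H x =>
      obtain ⟨a, ha, hx⟩ := hcover x
      refine ⟨QuotientGroup.mk ⟨a, ha⟩, ?_⟩
      obtain ⟨s, hs⟩ := QuotientGroup.mk_out_eq_mul S ⟨a, ha⟩
      change (QuotientGroup.mk ((Quotient.out _ : A) : E) : E ⧸ T) = _
      rw [hs, QuotientGroup.eq]
      have h1 : ((s : A) : E) ∈ T := hS1T ⟨s, s.2, rfl⟩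
      have := mul_mem (inv_mem h1) hx
      simpa [mul_assoc] using this
    exact Subgroup.finiteIndex_of_finite_quotient
  · let g : T →* Multiplicative ℤ := φ.comp T.subtype
    have hker : Group.IsSolvable g.ker := by
      obtain ⟨d, hd⟩ := hS1s.solvable
      let ι : g.ker →* E := T.subtype.comp g.ker.subtype
      have hι : Function.Injective ι := fun x y h => Subtype.ext (Subtype.ext h)
      let c : ℕ → (g.ker →* E) := fun n => (MulAut.conj (t ^ n)).toMonoidHom.comp ι
      have hcv : ∀ n x, c n x = t ^ n * ι x * (t ^ n)⁻¹ := fun n x => rfl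
      let P : ℕ → Subgroup g.ker := fun n => S1.comap (c n)
      have hP : Monotone P := by
        refine monotone_nat_of_le_succ fun n x hx => ?_
        change c (n + 1) x ∈ S1
        have := hS1 _ (show c n x ∈ S1 from hx)
        rw [hcv] at this ⊢
        rw [pow_succ']
        simpa [mul_assoc] using this
      have hcov : ∀ x, ∃ n, x ∈ P n := by
        intro x
        obtain ⟨n, m, h⟩ := x.1.2
        have h1 : φ (ι x) = 1 := x.2
        have h2 := hφA _ (hS1A h)
        have h3 : φ t ^ n = φ t ^ m := by
          change φ (t ^ n * ι x * (t ^ m)⁻¹) = 1 at h2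
          rw [map_mul, map_mul, h1, mul_one, map_inv, map_pow, map_pow] at h2
          exact mul_inv_eq_one.1 h2
        have h4 : n = m := by
          by_contra hne
          have h5 : (φ t) ^ ((n : ℤ) - m) = 1 := by rw [zpow_sub]; simp [h3]
          have := (IsMulTorsionFree.zpow_eq_one_iff_right hφt).1 h5
          lia
        subst h4
        exact ⟨n, h⟩
      refine ⟨d, ?_⟩
      rw [Subgroup.eq_bot_iff_forall]
      intro x hx
      obtain ⟨n, hn⟩ := derived_union P hP hcov d x hx
      have : derivedSeries (P n) d = ⊥ := by
        refine derived_injective ((c n).subgroupComap S1) ?_ d hd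
        intro x y hxy
        have h1 : c n x = c n y := congrArg Subtype.val hxy
        exact Subtype.ext (hι ((MulAut.conj (t ^ n)).injective h1))
      rw [this] at hn
      simpa using hn
    exact Group.isSolvable_of_ker_le_range g.ker.subtype g (by simp)

end Asc


section Main
variable {Γ : Type u} [Group Γ]

/-- the inductive property -/
def Q (Γ : Type u) [Group Γ] (G : Type*) [Group G] : Prop :=
  ∀ E : Subgroup Γ, Group.FG E → ∀ f : E →* G,
    (∀ L : Subgroup Γ, ∀ hL : L ≤ E, Group.FG L → (∀ x : L, f (Subgroup.inclusion hL x) = 1) →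
      VS L) → VS E

theorem VS.of_equiv {G H : Type*} [Group G] [Group H] (h : VS G) (e : G ≃* H) : VS H := by
  obtain ⟨K, hf, hs⟩ := h
  refine ⟨K.map e.toMonoidHom, ⟨?_⟩, ?_⟩
  · have := Subgroup.index_map_equiv K e
    exact this ▸ hf.index_ne_zero
  · exact Group.isSolvable_of_surjective (f := e.toMonoidHom.subgroupMap K)
      (e.toMonoidHom.subgroupMap_surjective K)

theorem VS.of_finiteIndex {G : Type*} [Group G] (M : Subgroup G) (hM : M.FiniteIndex)
    (h : VS M) : VS G := by
  obtain ⟨K, hf, hs⟩ := h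
  refine ⟨K.map M.subtype, ⟨?_⟩, ?_⟩
  · rw [Subgroup.index_map_subtype]
    exact mul_ne_zero hf.index_ne_zero hM.index_ne_zero
  · exact Group.isSolvable_of_surjective (f := M.subtype.subgroupMap K)
      (M.subtype.subgroupMap_surjective K)

theorem Q.of_injective {G H : Type*} [Group G] [Group H] (h : Q Γ H) (g : G →* H)
    (hg : Function.Injective g) : Q Γ G := by
  intro E hE f hf
  refine h E hE (g.comp f) fun L hL hLf hx => hf L hL hLf fun x => ?_
  have := hx x
  exact hg (by rw [map_one]; exact this)

theorem Q.ext {G H : Type*} [Group G] [Group H] (π : G →* H) (h1 : Q Γ π.ker) (h2 : Q Γ H) :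
    Q Γ G := by
  intro E hE f hf
  refine h2 E hE (π.comp f) fun L hL hLf hx => ?_
  refine h1 L hLf ((f.comp (Subgroup.inclusion hL)).codRestrict π.ker hx) ?_
  intro L' hL' hL'f hx'
  refine hf L' (hL'.trans hL) hL'f fun x => ?_
  exact congrArg Subtype.val (hx' x)

theorem Q.prod {G H : Type*} [Group G] [Group H] (h1 : Q Γ G) (h2 : Q Γ H) : Q Γ (G × H) := by
  refine Q.ext (MonoidHom.snd G H) (h1.of_injective
    ((MonoidHom.fst G H).comp (MonoidHom.ker _).subtype) ?_) h2
  rintro ⟨⟨a, b⟩, hb⟩ ⟨⟨c, d⟩, hd⟩ h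
  have hb' : b = 1 := hb
  have hd' : d = 1 := hd
  have h' : a = c := h
  subst hb' hd' h'
  rfl

theorem Q.of_finite {G : Type*} [Group G] (h : Finite G) : Q Γ G := by
  intro E hE f hf
  have hfi : f.ker.FiniteIndex := inferInstance
  refine VS.of_finiteIndex f.ker hfi ?_
  have e : f.ker ≃* f.ker.map E.subtype :=
    f.ker.equivMapOfInjective E.subtype E.subtype_injective
  have hfg : Group.FG f.ker := inferInstance
  refine VS.of_equiv (hf (f.ker.map E.subtype) (Subgroup.map_subtype_le _) ?_ ?_) e.symm
  · exact Group.fg_of_surjective (f := e.toMonoidHom) e.surjective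
  · rintro ⟨_, x, hx, rfl⟩
    exact hx

theorem Q.of_int (hF : NoF2 Γ) (hic : IndicablyCoherent Γ) : Q Γ (Multiplicative ℤ) := by
  intro E hE f hf
  by_cases htriv : f = 1
  · subst htriv
    exact hf E le_rfl hE fun _ => rfl
  -- make it surjective
  obtain ⟨φ, hφ, hker⟩ : ∃ φ : E →* Multiplicative ℤ, Function.Surjective φ ∧
      ∀ x, φ x = 1 → f x = 1 := by
    have hnt : Nontrivial f.range := by
      rw [Subgroup.nontrivial_iff_ne_bot]
      intro h
      exact htriv (MonoidHom.range_eq_bot_iff.1 h)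
    have hinf : Infinite f.range := by
      obtain ⟨y, hy⟩ := exists_ne (1 : f.range)
      exact Infinite.of_injective (fun n : ℤ => y ^ n) (by
        rw [injective_zpow_iff_not_isOfFinOrder]
        exact not_isOfFinOrder_of_isMulTorsionFree hy)
    let e : Multiplicative ℤ ≃* f.range := intCyclicMulEquiv
    refine ⟨e.symm.toMonoidHom.comp f.rangeRestrict,
      e.symm.surjective.comp f.rangeRestrict_surjective, fun x hx => ?_⟩
    have : f.rangeRestrict x = 1 := e.symm.injective (by rw [map_one]; exact hx)
    exact congrArg Subtype.val this
  obtain ⟨A, hAfg, C, D, ψ, e, he, hA, ht⟩ := hic E hE φ hφ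
  have hVSA : VS A := by
    let e' : A ≃* A.map E.subtype := A.equivMapOfInjective E.subtype E.subtype_injective
    refine VS.of_equiv (hf (A.map E.subtype) (Subgroup.map_subtype_le _) ?_ ?_) e'.symm
    · exact Group.fg_of_surjective (f := e'.toMonoidHom) e'.surjective
    · rintro ⟨_, x, hx, rfl⟩
      exact hker x (hA x hx)
  have hNo : NoF2 (HNNExtension A C D ψ) :=
    hF.of_injective (E.subtype.comp e.toMonoidHom) (E.subtype_injective.comp e.injective)
  have hgen : ∀ T : Subgroup E, A ≤ T → e HNNExtension.t ∈ T → T = ⊤ := by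
    intro T hAT htT
    rw [Subgroup.eq_top_iff']
    intro x
    obtain ⟨y, rfl⟩ := e.surjective x
    induction y using HNNExtension.induction_on with
    | of g => rw [he]; exact hAT g.2
    | t => exact htT
    | mul x y hx hy => rw [map_mul]; exact mul_mem hx hy
    | inv x hx => rw [map_inv]; exact inv_mem hx
  have ht1 : φ (e HNNExtension.t) ≠ 1 := by rw [ht]; decide
  rcases hnn_ascending hNo with hC | hD
  · refine asc A (e HNNExtension.t) φ hA ht1 ?_ hgen hVSA
    intro a ha
    have h1 : (⟨a, ha⟩ : A) ∈ C := hC ▸ Subgroup.mem_top _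
    have h2 := congrArg e (HNNExtension.equiv_eq_conj (φ := ψ) ⟨_, h1⟩)
    rw [map_mul, map_mul, map_inv, he, he] at h2
    rw [← h2]
    exact ((ψ ⟨_, h1⟩ : D) : A).2
  · refine asc A (e HNNExtension.t)⁻¹ φ hA (by simpa using ht1) ?_ ?_ hVSA
    · intro a ha
      have h1 : (⟨a, ha⟩ : A) ∈ D := hD ▸ Subgroup.mem_top _
      have h2 := congrArg e (HNNExtension.equiv_symm_eq_conj (φ := ψ) ⟨_, h1⟩)
      rw [map_mul, map_mul, map_inv, he, he] at h2
      rw [inv_inv, ← h2]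
      exact ((ψ.symm ⟨_, h1⟩ : C) : A).2
    · intro T hAT htT
      exact hgen T hAT (by simpa using htT)

theorem Q.pi_int (hF : NoF2 Γ) (hic : IndicablyCoherent Γ) (n : ℕ) :
    Q Γ (Fin n → Multiplicative ℤ) := by
  induction n with
  | zero => exact Q.of_finite inferInstance
  | succ n ih =>
    refine ((Q.of_int hF hic).prod ih).of_injective
      (((Pi.evalMonoidHom (fun _ : Fin (n + 1) => Multiplicative ℤ) 0)).prod
        (MonoidHom.mk' (fun x i => x (Fin.succ i)) (fun _ _ => rfl))) ?_
    intro x y h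
    funext i
    have h1 := congrArg Prod.fst h
    have h2 := congrArg Prod.snd h
    cases i using Fin.cases with
    | zero => exact h1
    | succ i => exact congrFun h2 i

theorem Q.of_comm (hF : NoF2 Γ) (hic : IndicablyCoherent Γ) {G : Type*} [Group G]
    (hG : ∀ a b : G, a * b = b * a) : Q Γ G := by
  intro E hE f hf
  let _ : CommGroup f.range :=
    { (inferInstance : Group f.range) with mul_comm := fun a b => Subtype.ext (hG _ _) }
  have hfg : Group.FG f.range := Group.fg_range f
  obtain ⟨ι, j, _, _, p, hp, e, ⟨ε⟩⟩ :=
    CommGroup.equiv_free_prod_prod_multiplicative_zmod f.range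
  have hne : ∀ i, NeZero (p i ^ e i) := fun i => ⟨pow_ne_zero _ (hp i).ne_zero⟩
  have hfin : ∀ i, Finite (Multiplicative (ZMod (p i ^ e i))) := fun i =>
    inferInstanceAs (Finite (ZMod (p i ^ e i)))
  have h1 : Q Γ (j → Multiplicative ℤ) :=
    (Q.pi_int hF hic (Fintype.card j)).of_injective
      (MonoidHom.mk' (fun x i => x ((Fintype.equivFin j).symm i)) (fun _ _ => rfl)) (by
        intro x y h
        funext i
        have := congrFun h (Fintype.equivFin j i)
        simpa using this)
  have h2 : Q Γ f.range := (h1.prod (Q.of_finite inferInstance)).of_injective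
    ε.toMonoidHom ε.injective
  exact h2 E hE f.rangeRestrict fun L hL hLf hx => hf L hL hLf fun x =>
    congrArg Subtype.val (hx x)

theorem Q.of_EA (hF : NoF2 Γ) (hic : IndicablyCoherent Γ) (G : Type u) [Group G]
    (h : ElementaryAmenable G) : Q Γ G := by
  induction h with
  | of_finite G h => exact Q.of_finite h
  | of_comm G h => exact Q.of_comm hF hic h
  | of_mulEquiv G H e h ih => exact ih.of_injective e.symm.toMonoidHom e.symm.injective
  | of_extension G N hN h1 h2 ih1 ih2 =>
    refine Q.ext (QuotientGroup.mk' N) ?_ ih2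
    rw [QuotientGroup.ker_mk']
    exact ih1
  | of_directedUnion G ι S hdir hcov h ih =>
    intro E hE f hf
    classical
    have hr : ∃ i, f.range ≤ S i := by
      have hfg : Group.FG f.range := Group.fg_range f
      obtain ⟨s, hs⟩ := (Group.fg_iff_subgroup_fg _).1 hfg
      have : Nonempty ι := ⟨(hcov 1).choose⟩
      choose g hg using hcov
      obtain ⟨k, hk⟩ := hdir.finset_le (s.image g)
      refine ⟨k, ?_⟩
      rw [← hs, Subgroup.closure_le]
      intro x hx
      exact hk (g x) (Finset.mem_image_of_mem _ hx) (hg x)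
    obtain ⟨i, hi⟩ := hr
    exact ih i E hE (f.codRestrict (S i) fun x => hi ⟨x, rfl⟩) fun L hL hLf hx =>
      hf L hL hLf fun x => congrArg Subtype.val (hx x)

end Main

end IC

/-- Every finitely generated elementary amenable indicably coherent group is virtually
soluble. -/
theorem virtuallySolvable_of_indicablyCoherent (G : Type u) [Group G]
    (hEA : ElementaryAmenable G) (hfg : Group.FG G) (hic : IndicablyCoherent G) :
    ∃ H : Subgroup G, H.FiniteIndex ∧ IsSolvable H := by
  have hF := IC.noF2_of_EA G hEA
  have hQ := IC.Q.of_EA hF hic G hEA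
  have hVS : IC.VS (⊤ : Subgroup G) := by
    refine hQ ⊤ ?_ (Subgroup.subtype ⊤) ?_
    · exact Group.fg_of_surjective (f := (Subgroup.topEquiv (G := G)).symm.toMonoidHom)
        (Subgroup.topEquiv (G := G)).symm.surjective
    · intro L hL hLf hx
      have : Subsingleton L := ⟨fun a b => Subtype.ext ((hx a).trans (hx b).symm)⟩
      exact ⟨⊤, inferInstance, inferInstance⟩
  exact hVS.of_equiv Subgroup.topEquiv
end

section
/- Let G be a finitely generated elementary amenable group. If G is homologically coherent, then G is virtually soluble. -/
universe u v

/-- A group `G` is of type `FP₂` if the trivial module `ℤ` admits a projective resolution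
over the integral group ring `ℤG` which is finitely generated in degrees `0`, `1` and `2`;
equivalently, there is a partial projective resolution
`P₂ → P₁ → P₀ → ℤ → 0` by finitely generated projective `ℤG`-modules. -/
def Group.IsTypeFP2 (G : Type u) [Group G] : Prop :=
  ∃ (P₀ P₁ P₂ : ModuleCat.{u} (MonoidAlgebra ℤ G))
    (d₂ : P₂ →ₗ[MonoidAlgebra ℤ G] P₁) (d₁ : P₁ →ₗ[MonoidAlgebra ℤ G] P₀)
    (ε : P₀ →ₗ[MonoidAlgebra ℤ G] (Representation.trivial ℤ (G := G) (V := ℤ)).asModule),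
    Module.Finite (MonoidAlgebra ℤ G) P₀ ∧ Module.Projective (MonoidAlgebra ℤ G) P₀ ∧
    Module.Finite (MonoidAlgebra ℤ G) P₁ ∧ Module.Projective (MonoidAlgebra ℤ G) P₁ ∧
    Module.Finite (MonoidAlgebra ℤ G) P₂ ∧ Module.Projective (MonoidAlgebra ℤ G) P₂ ∧
    Function.Surjective ε ∧ LinearMap.range d₁ = LinearMap.ker ε ∧
    LinearMap.range d₂ = LinearMap.ker d₁

/-- A group is homologically coherent if every finitely generated subgroup is of type `FP₂`. -/
def Group.IsHomologicallyCoherent (G : Type u) [Group G] : Prop :=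
  ∀ H : Subgroup G, Group.FG H → Group.IsTypeFP2 H

section Part1
open MonoidAlgebra

lemma EA.fp_of_fp_pair {R : Type*} [Ring R] {P₀ P₁ P₂ Z Q₀ : Type*}
    [AddCommGroup P₀] [Module R P₀] [AddCommGroup P₁] [Module R P₁] [AddCommGroup P₂] [Module R P₂]
    [AddCommGroup Z] [Module R Z] [AddCommGroup Q₀] [Module R Q₀]
    (d₂ : P₂ →ₗ[R] P₁) (d₁ : P₁ →ₗ[R] P₀) (ε : P₀ →ₗ[R] Z) (η : Q₀ →ₗ[R] Z)
    [Module.Projective R P₀]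
    [Module.Finite R P₁] [Module.Projective R P₁] [Module.Finite R P₂]
    [Module.Finite R Q₀] [Module.Projective R Q₀]
    (hε : Function.Surjective ε) (hη : Function.Surjective η)
    (h1 : LinearMap.range d₁ = LinearMap.ker ε) (h2 : LinearMap.range d₂ = LinearMap.ker d₁) :
    Module.FinitePresentation R (LinearMap.ker η) := by
  have : Module.FinitePresentation R P₁ := Module.finitePresentation_of_projective _ _
  have : Module.FinitePresentation R Q₀ := Module.finitePresentation_of_projective _ _
  have hk : Module.FinitePresentation R (LinearMap.range d₁) := by
    refine Module.finitePresentation_of_surjective d₁.rangeRestrict d₁.surjective_rangeRestrict ?_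
    rw [LinearMap.ker_rangeRestrict, ← h2]
    exact Submodule.fg_range _
  rw [h1] at hk
  -- pullback
  let E : Submodule R (P₀ × Q₀) :=
    LinearMap.ker (ε.comp (LinearMap.fst R P₀ Q₀) - η.comp (LinearMap.snd R P₀ Q₀))
  have hE : ∀ p q, (p, q) ∈ E ↔ ε p = η q := by
    intro p q
    simp [E, sub_eq_zero]
  let π₀ : E →ₗ[R] P₀ := (LinearMap.fst R P₀ Q₀).comp E.subtype
  let π₁ : E →ₗ[R] Q₀ := (LinearMap.snd R P₀ Q₀).comp E.subtype
  have hπ₀ : Function.Surjective π₀ := by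
    intro p
    obtain ⟨q, hq⟩ := hη (ε p)
    exact ⟨⟨(p, q), (hE _ _).2 hq.symm⟩, rfl⟩
  have hπ₁ : Function.Surjective π₁ := by
    intro q
    obtain ⟨p, hp⟩ := hε (η q)
    exact ⟨⟨(p, q), (hE _ _).2 hp⟩, rfl⟩
  have hE1 : Module.FinitePresentation R (LinearMap.ker π₁) := by
    let e : LinearMap.ker ε ≃ₗ[R] LinearMap.ker π₁ :=
      LinearEquiv.ofBijective
        (LinearMap.codRestrict (LinearMap.ker π₁)
          (LinearMap.codRestrict E ((LinearMap.inl R P₀ Q₀).comp (LinearMap.ker ε).subtype)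
            (by rintro ⟨p, hp⟩; exact (hE p 0).2 (by simpa using hp)))
          (by rintro ⟨p, hp⟩; rfl))
        (by
          constructor
          · rintro ⟨p, hp⟩ ⟨q, hq⟩ h
            have := congrArg (fun z => z.1.1.1) h
            exact Subtype.ext this
          · rintro ⟨⟨⟨p, q⟩, hpq⟩, h⟩
            have hq : q = 0 := h
            subst hq
            exact ⟨⟨p, by simpa using (hE _ _).1 hpq⟩, rfl⟩)
    exact Module.FinitePresentation.of_equiv (R := R) (M := LinearMap.ker ε) (N := LinearMap.ker π₁) e
  have hEE : Module.FinitePresentation R E := Module.finitePresentation_of_ker π₁ hπ₁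
  let f : LinearMap.ker η →ₗ[R] E :=
    LinearMap.codRestrict E ((LinearMap.inr R P₀ Q₀).comp (LinearMap.ker η).subtype)
      (by rintro ⟨q, hq⟩; exact (hE 0 q).2 (by simpa using (show η q = 0 from hq).symm))
  refine Module.finitePresentation_of_projective_of_exact f π₀ ?_ hπ₀ ?_
  · rintro ⟨p, hp⟩ ⟨q, hq⟩ h
    have := congrArg (fun z => z.1.2) h
    exact Subtype.ext this
  · rintro ⟨⟨p, q⟩, hpq⟩
    constructor
    · intro h
      have hp : p = 0 := h
      subst hp
      exact ⟨⟨q, by simpa using ((hE _ _).1 hpq).symm⟩, rfl⟩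
    · rintro ⟨⟨q', hq'⟩, h⟩
      rw [← h]; rfl

/-- the boundary map of the Cayley graph -/
noncomputable def EA.bd {G : Type u} [Group G] {X : Type v} [Fintype X] (x : X → G) :
    (X → MonoidAlgebra ℤ G) →ₗ[MonoidAlgebra ℤ G] MonoidAlgebra ℤ G :=
  Fintype.linearCombination (MonoidAlgebra ℤ G) (fun i => of ℤ G (x i) - 1)

lemma EA.bd_apply {G : Type u} [Group G] {X : Type v} [Fintype X] (x : X → G)
    (r : X → MonoidAlgebra ℤ G) : EA.bd x r = ∑ i, r i * (of ℤ G (x i) - 1) := by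
  simp [EA.bd, Fintype.linearCombination_apply]

lemma EA.of_sub_one_mem {G : Type u} [Group G] {X : Type v} [Fintype X] (x : X → G)
    (hx : Subgroup.closure (Set.range x) = ⊤) (g : G) :
    of ℤ G g - 1 ∈ LinearMap.range (EA.bd x) := by
  classical
  have hg : g ∈ Subgroup.closure (Set.range x) := by rw [hx]; trivial
  induction hg using Subgroup.closure_induction with
  | mem y hy =>
    obtain ⟨i, rfl⟩ := hy
    refine ⟨Pi.single i 1, ?_⟩
    rw [EA.bd, Fintype.linearCombination_apply_single, one_smul]
  | one => rw [map_one, sub_self]; exact Submodule.zero_mem _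
  | mul a b _ _ ha hb =>
    have : of ℤ G (a * b) - 1 = (of ℤ G a - 1) + of ℤ G a • (of ℤ G b - 1) := by
      rw [map_mul, smul_eq_mul, mul_sub]; simp
    rw [this]
    exact Submodule.add_mem _ ha (Submodule.smul_mem _ _ hb)
  | inv a _ ha =>
    have : of ℤ G a⁻¹ - 1 = - (of ℤ G a⁻¹ • (of ℤ G a - 1)) := by
      rw [smul_eq_mul, mul_sub, ← map_mul, inv_mul_cancel, map_one, mul_one, neg_sub]
    rw [this]
    exact Submodule.neg_mem _ (Submodule.smul_mem _ _ ha)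

lemma EA.ker_bd_fg {G : Type u} [Group G] (hFP : Group.IsTypeFP2 G) {X : Type v} [Fintype X]
    (x : X → G) (hx : Subgroup.closure (Set.range x) = ⊤) :
    (LinearMap.ker (EA.bd x)).FG := by
  classical
  obtain ⟨P₀, P₁, P₂, d₂, d₁, ε, f0, p0, f1, p1, f2, p2, hε, h1, h2⟩ := hFP
  let ρ : Representation ℤ G ℤ := Representation.trivial ℤ (G := G) (V := ℤ)
  let η : MonoidAlgebra ℤ G →ₗ[MonoidAlgebra ℤ G] ρ.asModule :=
    LinearMap.toSpanSingleton _ _ (ρ.asModuleEquiv.symm 1)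
  have hηs : ∀ (g : G) (n : ℤ), η (single g n) = ρ.asModuleEquiv.symm n := by
    intro g n
    rw [LinearMap.toSpanSingleton_apply, Representation.single_smul]
    simp only [LinearEquiv.apply_symm_apply, ρ, Representation.trivial]
    change n • (1 : ℤ) = n
    simp
  have hη : Function.Surjective η := fun n => ⟨single 1 (ρ.asModuleEquiv n), by rw [hηs]; simp⟩
  have hfp := EA.fp_of_fp_pair d₂ d₁ ε η hε hη h1 h2
  have hrange : LinearMap.range (EA.bd x) = LinearMap.ker η := by
    apply le_antisymm
    · rintro _ ⟨r, rfl⟩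
      rw [EA.bd_apply]
      refine Submodule.sum_mem _ fun i _ => ?_
      rw [← smul_eq_mul]
      refine Submodule.smul_mem _ _ ?_
      rw [LinearMap.mem_ker, map_sub, of_apply, one_def, hηs, hηs, sub_self]
    · intro r hr
      have key : ∀ r : MonoidAlgebra ℤ G,
          r - single 1 (ρ.asModuleEquiv (η r)) ∈ LinearMap.range (EA.bd x) := by
        intro r
        induction r using MonoidAlgebra.induction_on with
        | of g =>
          rw [of_apply, hηs]
          exact EA.of_sub_one_mem x hx g
        | add a b ha hb =>
          have := Submodule.add_mem _ ha hb
          rw [map_add, map_add, single_add]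
          convert this using 1
          abel
        | smul n a ha =>
          have := zsmul_mem ha n
          rw [map_zsmul η n a, map_zsmul, ← smul_single, ← zsmul_sub]
          exact this
      have := key r
      rw [LinearMap.mem_ker.1 hr] at this
      simpa using this
  rw [← hrange] at hfp
  have := Module.FinitePresentation.fg_ker (EA.bd x).rangeRestrict
    (EA.bd x).surjective_rangeRestrict
  rwa [LinearMap.ker_rangeRestrict] at this
end Part1

section Part2
open MonoidAlgebra

/-- conjugate subgroup -/
def EA.cj {G : Type u} [Group G] (t : G) (B : Subgroup G) : Subgroup G :=
  B.map (MulAut.conj t).toMonoidHom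

lemma EA.mem_cj {G : Type u} [Group G] (t : G) (B : Subgroup G) (g : G) :
    g ∈ EA.cj t B ↔ t⁻¹ * g * t ∈ B := by
  constructor
  · rintro ⟨b, hb, rfl⟩
    simpa [mul_assoc] using hb
  · intro h
    exact ⟨_, h, by simp [mul_assoc]⟩

lemma EA.cj_mono {G : Type u} [Group G] (t : G) {B B' : Subgroup G} (h : B ≤ B') :
    EA.cj t B ≤ EA.cj t B' := Subgroup.map_mono h

/-- increasing sequence of base groups -/
def EA.BB {G : Type u} [Group G] (t : G) (B : Subgroup G) : ℕ → Subgroup G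
  | 0 => B
  | k + 1 => EA.BB t B k ⊔ EA.cj t (EA.BB t B k)

lemma EA.BB_mono {G : Type u} [Group G] (t : G) (B : Subgroup G) : Monotone (EA.BB t B) :=
  monotone_nat_of_le_succ fun k => by rw [EA.BB]; exact le_sup_left

/-- projection of the group ring to the coset module -/
noncomputable def EA.pr {G : Type u} [Group G] (C : Subgroup G) :
    MonoidAlgebra ℤ G →+ (G ⧸ C →₀ ℤ) where
  toFun r := Finsupp.mapDomain (QuotientGroup.mk) r.coeff
  map_zero' := by simp
  map_add' a b := by simp [Finsupp.mapDomain_add]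

lemma EA.pr_single {G : Type u} [Group G] (C : Subgroup G) (g : G) (n : ℤ) :
    EA.pr C (single g n) = Finsupp.single (g : G ⧸ C) n := by
  simp [EA.pr]

lemma EA.pr_of_mul {G : Type u} [Group G] (C : Subgroup G) (g : G) (r : MonoidAlgebra ℤ G)
    (q : G ⧸ C) : EA.pr C (of ℤ G g * r) q = EA.pr C r (g⁻¹ • q) := by
  classical
  induction r using MonoidAlgebra.induction_on with
  | of h =>
    rw [← map_mul, of_apply, of_apply, EA.pr_single, EA.pr_single, Finsupp.single_apply,
      Finsupp.single_apply]
    congr 1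
    rw [eq_iff_iff, eq_inv_smul_iff]
    rfl
  | add a b ha hb => rw [mul_add, map_add, map_add, Finsupp.add_apply, Finsupp.add_apply, ha, hb]
  | smul n a ha =>
    rw [mul_smul_comm, map_zsmul, map_zsmul, Finsupp.smul_apply, Finsupp.smul_apply, ha]

lemma EA.pr_mul_zero {G : Type u} [Group G] (C : Subgroup G) (s r : MonoidAlgebra ℤ G)
    (hr : EA.pr C r = 0) : EA.pr C (s * r) = 0 := by
  induction s using MonoidAlgebra.induction_on with
  | of h => ext q; rw [EA.pr_of_mul, hr]; rfl
  | add a b ha hb => rw [add_mul, map_add, ha, hb, add_zero]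
  | smul n a ha => rw [smul_mul_assoc, map_zsmul, ha, smul_zero]

lemma EA.pr_mono {G : Type u} [Group G] {C C' : Subgroup G} (h : C ≤ C') (r : MonoidAlgebra ℤ G)
    (hr : EA.pr C r = 0) : EA.pr C' r = 0 := by
  have : EA.pr C' r = Finsupp.mapDomain (Subgroup.quotientMapOfLE h) (EA.pr C r) := by
    simp only [EA.pr, AddMonoidHom.coe_mk, ZeroHom.coe_mk]
    rw [← Finsupp.mapDomain_comp]
    rfl
  rw [this, hr, Finsupp.mapDomain_zero]

lemma EA.pr_limit {G : Type u} [Group G] (C : ℕ → Subgroup G) (hC : Monotone C)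
    (r : MonoidAlgebra ℤ G) (hr : EA.pr (⨆ k, C k) r = 0) : ∃ k, EA.pr (C k) r = 0 := by
  classical
  have hk : ∃ k, ∀ g ∈ r.coeff.support, ∀ h ∈ r.coeff.support,
      g⁻¹ * h ∈ (⨆ k, C k) → g⁻¹ * h ∈ C k := by
    have : ∀ p : G × G, ∃ k, p.1⁻¹ * p.2 ∈ (⨆ k, C k) → p.1⁻¹ * p.2 ∈ C k := by
      intro p
      by_cases hp : p.1⁻¹ * p.2 ∈ (⨆ k, C k)
      · obtain ⟨k, hk⟩ := (Subgroup.mem_iSup_of_directed hC.directed_le).1 hp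
        exact ⟨k, fun _ => hk⟩
      · exact ⟨0, fun h => absurd h hp⟩
    choose f hf using this
    refine ⟨(r.coeff.support ×ˢ r.coeff.support).sup f, fun g hg h hh hgh => ?_⟩
    exact hC (Finset.le_sup (f := f) (b := (g, h)) (Finset.mem_product.2 ⟨hg, hh⟩)) (hf (g, h) hgh)
  obtain ⟨k, hk⟩ := hk
  refine ⟨k, ?_⟩
  have e : EA.pr (⨆ k, C k) r =
      Finsupp.mapDomain (Subgroup.quotientMapOfLE (le_iSup C k)) (EA.pr (C k) r) := by
    simp only [EA.pr, AddMonoidHom.coe_mk, ZeroHom.coe_mk]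
    rw [← Finsupp.mapDomain_comp]
    rfl
  rw [hr] at e
  have hinj : Set.InjOn (Subgroup.quotientMapOfLE (le_iSup C k))
      ((QuotientGroup.mk : G → G ⧸ C k) '' (r.coeff.support : Set G)) := by
    rintro _ ⟨g, hg, rfl⟩ _ ⟨h, hh, rfl⟩ hgh
    have h1 : ((g : G) : G ⧸ (⨆ k, C k)) = h := hgh
    exact QuotientGroup.eq.2 (hk g hg h hh (QuotientGroup.eq.1 h1))
  refine Finsupp.mapDomain_injOn _ hinj ?_ ?_ ?_
  · intro q hq
    have := Finsupp.mapDomain_support hq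
    simpa using this
  · simp
  · rw [← e, Finsupp.mapDomain_zero]

lemma EA.shift_zero {Q : Type*} (d : Q → ℤ) (ρ : Q → Q) (hρ : ∀ q, d (ρ q) = d q - 1)
    (z : Q →₀ ℤ) (hz : Finsupp.mapDomain ρ z = z) : z = 0 := by
  classical
  by_contra hne
  have hs : z.support.Nonempty := Finsupp.support_nonempty_iff.2 hne
  obtain ⟨q, hq, hmax⟩ := Finset.exists_max_image z.support d hs
  rw [← hz] at hq
  obtain ⟨q', hq', rfl⟩ := Finset.mem_image.1 (Finsupp.mapDomain_support hq)
  obtain ⟨q'', hq'', hmax'⟩ := Finset.exists_max_image z.support d hs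
  have := hmax' q' hq'
  have h2 := hq''
  rw [← hz] at h2
  obtain ⟨q3, hq3, h3⟩ := Finset.mem_image.1 (Finsupp.mapDomain_support h2)
  have h4 := hmax' q3 hq3
  have h5 := hρ q3
  rw [h3] at h5
  omega

lemma EA.pr_asc {G : Type u} [Group G] (χ : G →* Multiplicative ℤ) (t : G)
    (ht : χ t = Multiplicative.ofAdd 1) (B : Subgroup G) (hB : B ≤ χ.ker) (hBt : EA.cj t B ≤ B)
    (s : MonoidAlgebra ℤ G) (hs : EA.pr B (s * (of ℤ G t - 1)) = 0) :
    EA.pr (EA.cj t B) s = 0 := by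
  classical
  let ι : G ⧸ EA.cj t B → G ⧸ B := Quotient.lift (fun g : G => ((g * t : G) : G ⧸ B)) (by
    intro a b hab
    have hab := QuotientGroup.leftRel_apply.1 hab
    rw [EA.mem_cj] at hab
    refine QuotientGroup.eq.2 ?_
    convert hab using 1
    group)
  have hι : Function.Injective ι := by
    intro a b
    induction a using QuotientGroup.induction_on
    induction b using QuotientGroup.induction_on
    rename_i a b
    intro h
    have h : ((a * t : G) : G ⧸ B) = ((b * t : G) : G ⧸ B) := h
    refine QuotientGroup.eq.2 ?_
    rw [EA.mem_cj]
    convert QuotientGroup.eq.1 h using 1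
    group
  let ρ : G ⧸ B → G ⧸ B := Quotient.lift (fun g : G => ((g * t⁻¹ : G) : G ⧸ B)) (by
    intro a b hab
    have hab := QuotientGroup.leftRel_apply.1 hab
    refine QuotientGroup.eq.2 (hBt ?_)
    rw [EA.mem_cj]
    convert hab using 1
    group)
  let d : G ⧸ B → ℤ := Quotient.lift (fun g : G => (χ g).toAdd) (by
    intro a b hab
    have hab := hB (QuotientGroup.leftRel_apply.1 hab)
    rw [MonoidHom.mem_ker, map_mul, map_inv, inv_mul_eq_one] at hab
    simp only [hab])
  have hρ : ∀ q, d (ρ q) = d q - 1 := by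
    intro q
    induction q using QuotientGroup.induction_on
    rename_i g
    change (χ (g * t⁻¹)).toAdd = (χ g).toAdd - 1
    rw [map_mul, map_inv, ht]
    simp [sub_eq_add_neg]
  have e1 : Finsupp.mapDomain ι (EA.pr (EA.cj t B) s) = EA.pr B (s * of ℤ G t) := by
    clear hs
    induction s using MonoidAlgebra.induction_on with
    | of h =>
      rw [← map_mul, of_apply, of_apply, EA.pr_single, EA.pr_single, Finsupp.mapDomain_single]
      rfl
    | add a b ha hb => rw [add_mul, map_add, map_add, Finsupp.mapDomain_add, ha, hb]
    | smul n a ha =>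
      rw [smul_mul_assoc, map_zsmul, map_zsmul, Finsupp.mapDomain_smul, ha]
  have e2 : Finsupp.mapDomain ρ (EA.pr B (s * of ℤ G t)) = EA.pr B s := by
    clear hs e1
    induction s using MonoidAlgebra.induction_on with
    | of h =>
      rw [← map_mul, of_apply, of_apply, EA.pr_single, EA.pr_single, Finsupp.mapDomain_single]
      congr 1
      change ((h * t * t⁻¹ : G) : G ⧸ B) = h
      rw [mul_inv_cancel_right]
    | add a b ha hb => rw [add_mul, map_add, map_add, Finsupp.mapDomain_add, ha, hb]
    | smul n a ha =>
      rw [smul_mul_assoc, map_zsmul, map_zsmul, Finsupp.mapDomain_smul, ha]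
  have e3 : EA.pr B (s * of ℤ G t) = EA.pr B s := by
    rw [mul_sub, mul_one, map_sub, sub_eq_zero] at hs
    exact hs
  have e4 := EA.shift_zero d ρ hρ (EA.pr B (s * of ℤ G t)) (by rw [e2, e3])
  apply Finsupp.mapDomain_injective hι
  rw [e1, e4, Finsupp.mapDomain_zero]

lemma EA.BB_sup_cj {G : Type u} [Group G] (t : G) (B : Subgroup G) :
    EA.cj t (⨆ k, EA.BB t B k) = ⨆ k, EA.cj t (EA.BB t B k) := by
  rw [EA.cj, Subgroup.map_iSup]; rfl

lemma EA.BB_cj_le {G : Type u} [Group G] (t : G) (B : Subgroup G) (k : ℕ) :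
    EA.cj t (EA.BB t B k) ≤ EA.BB t B (k + 1) := by
  rw [EA.BB]; exact le_sup_right

lemma EA.BB_le_ker {G : Type u} [Group G] (χ : G →* Multiplicative ℤ) (t : G) (B : Subgroup G)
    (hB : B ≤ χ.ker) (k : ℕ) : EA.BB t B k ≤ χ.ker := by
  induction k with
  | zero => exact hB
  | succ k ih =>
    rw [EA.BB]
    refine sup_le ih ?_
    intro g hg
    rw [EA.mem_cj] at hg
    have := ih hg
    rw [MonoidHom.mem_ker] at this ⊢
    rw [map_mul, map_mul, mul_right_comm, map_inv] at this
    simpa using this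

theorem EA.exists_deriv {G : Type u} [Group G] (hFP : Group.IsTypeFP2 G)
    (χ : G →* Multiplicative ℤ) {X : Type v} [Fintype X] (x : X → G)
    (hx : Subgroup.closure (Set.range x) = ⊤) (i₀ : X) (ht : χ (x i₀) = Multiplicative.ofAdd 1)
    (B : Subgroup G) (hBc : B = Subgroup.closure (x '' {i | i ≠ i₀})) (hB : B ≤ χ.ker) :
    ∃ (k : ℕ) (δ : G → G ⧸ EA.cj (x i₀) (EA.BB (x i₀) B k) → ℤ),
      (∀ g h q, δ (g * h) q = δ g q + δ h (g⁻¹ • q)) ∧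
      (∀ q, δ (x i₀) q ≠ 0 ↔ q = ((1 : G) : G ⧸ EA.cj (x i₀) (EA.BB (x i₀) B k))) ∧
      δ (x i₀) ((1 : G) : G ⧸ EA.cj (x i₀) (EA.BB (x i₀) B k)) = 1 ∧
      ∀ b ∈ EA.BB (x i₀) B (k + 1), ∀ q, δ b q = 0 := by
  classical
  set t := x i₀ with htdef
  let C : ℕ → Subgroup G := fun k => EA.cj t (EA.BB t B k)
  have hCmono : Monotone C := fun i j h => EA.cj_mono t (EA.BB_mono t B h)
  let Bi : Subgroup G := ⨆ k, EA.BB t B k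
  have hBi : Bi ≤ χ.ker := iSup_le fun k => EA.BB_le_ker χ t B hB k
  have hBit : EA.cj t Bi ≤ Bi := by
    rw [EA.BB_sup_cj]
    exact iSup_le fun k => (EA.BB_cj_le t B k).trans (le_iSup _ (k + 1))
  have hinf : ∀ r ∈ LinearMap.ker (EA.bd x), EA.pr (⨆ k, C k) (r i₀) = 0 := by
    intro r hr
    rw [← EA.BB_sup_cj]
    refine EA.pr_asc χ t ht Bi hBi hBit _ ?_
    rw [LinearMap.mem_ker, EA.bd_apply] at hr
    have h2 := congrArg (EA.pr Bi) hr
    rw [map_sum, map_zero, Finset.sum_eq_single i₀] at h2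
    · exact h2
    · intro i _ hi
      apply EA.pr_mul_zero
      have : x i ∈ Bi := by
        refine (le_iSup (EA.BB t B) 0) ?_
        rw [EA.BB, hBc]
        exact Subgroup.subset_closure ⟨i, hi, rfl⟩
      rw [map_sub, of_apply, one_def, EA.pr_single, EA.pr_single, sub_eq_zero]
      congr 1
      refine (QuotientGroup.eq.2 ?_).symm
      simpa using this
    · simp
  obtain ⟨S, hS⟩ := EA.ker_bd_fg hFP x hx
  have hlim : ∀ r : X → MonoidAlgebra ℤ G, ∃ k, r ∈ LinearMap.ker (EA.bd x) →
      EA.pr (C k) (r i₀) = 0 := by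
    intro r
    by_cases hr : r ∈ LinearMap.ker (EA.bd x)
    · obtain ⟨k, hk⟩ := EA.pr_limit C hCmono _ (hinf r hr)
      exact ⟨k, fun _ => hk⟩
    · exact ⟨0, fun h => absurd h hr⟩
  choose f hf using hlim
  let k := S.sup f
  have hker : ∀ r ∈ LinearMap.ker (EA.bd x), EA.pr (C k) (r i₀) = 0 := by
    intro r hr
    rw [← hS] at hr
    induction hr using Submodule.span_induction with
    | mem r hr =>
      refine EA.pr_mono (hCmono (Finset.le_sup (f := f) hr)) _ (hf r ?_)
      rw [← hS]; exact Submodule.subset_span hr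
    | zero => simp
    | add a b _ _ ha hb => rw [Pi.add_apply, map_add, ha, hb, add_zero]
    | smul s a _ ha =>
      rw [Pi.smul_apply, smul_eq_mul]
      exact EA.pr_mul_zero _ _ _ ha
  have hlift : ∀ g : G, ∃ r, EA.bd x r = of ℤ G g - 1 := fun g => EA.of_sub_one_mem x hx g
  choose L hL using hlift
  let δ : G → G ⧸ C k → ℤ := fun g q => EA.pr (C k) (L g i₀) q
  have huniq : ∀ g r, EA.bd x r = of ℤ G g - 1 → ∀ q, δ g q = EA.pr (C k) (r i₀) q := by
    intro g r hr q
    have := hker (L g - r) (by rw [LinearMap.mem_ker, map_sub, hL, hr, sub_self])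
    rw [Pi.sub_apply, map_sub, sub_eq_zero] at this
    simp only [δ, this]
  have hmul : ∀ g h q, δ (g * h) q = δ g q + δ h (g⁻¹ • q) := by
    intro g h q
    rw [huniq (g * h) (L g + of ℤ G g • L h) (by
      rw [map_add, map_smul, hL, hL, map_mul, smul_eq_mul, mul_sub]; simp)]
    rw [Pi.add_apply, map_add, Finsupp.add_apply, Pi.smul_apply, smul_eq_mul, EA.pr_of_mul]
  have hgen : ∀ i q, δ (x i) q = EA.pr (C k) ((Pi.single i 1 : X → MonoidAlgebra ℤ G) i₀) q := by
    intro i q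
    refine huniq _ _ ?_ q
    rw [EA.bd, Fintype.linearCombination_apply_single, one_smul]
  have hone : ∀ q, δ 1 q = 0 := by
    intro q
    have := hmul 1 1 q
    simp only [mul_one, inv_one, one_smul] at this
    omega
  have hinv : ∀ g q, δ g⁻¹ q = - δ g (g • q) := by
    intro g q
    have := hmul g⁻¹ g q
    rw [inv_mul_cancel, hone, inv_inv] at this
    omega
  have htv : ∀ q, δ t q = if ((1 : G) : G ⧸ C k) = q then 1 else 0 := by
    intro q
    rw [htdef, hgen, Pi.single_eq_same, one_def, EA.pr_single, Finsupp.single_apply]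
  have hBz : ∀ j ≤ k + 1, ∀ b ∈ EA.BB t B j, ∀ q, δ b q = 0 := by
    intro j
    induction j with
    | zero =>
      intro _ b hb
      rw [EA.BB, hBc] at hb
      induction hb using Subgroup.closure_induction with
      | mem y hy =>
        obtain ⟨i, hi, rfl⟩ := hy
        intro q
        rw [hgen, Pi.single_eq_of_ne (Ne.symm hi), map_zero]
        rfl
      | one => exact hone
      | mul a b _ _ ha hb => intro q; rw [hmul, ha, hb, add_zero]
      | inv a _ ha => intro q; rw [hinv, ha, neg_zero]
    | succ j ih =>
      intro hj b hb
      have ih := ih (by omega)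
      rw [EA.BB, Subgroup.sup_eq_closure] at hb
      induction hb using Subgroup.closure_induction with
      | mem y hy =>
        intro q
        rcases hy with hy | hy
        · exact ih y hy q
        · have hyC : y ∈ C k := hCmono (by omega : j ≤ k) hy
          have h1 := (EA.mem_cj _ _ _).1 hy
          have h2 := ih _ h1 (t⁻¹ • q)
          have h3 : y = t * (t⁻¹ * y * t) * t⁻¹ := by group
          rw [h3, hmul, hmul, hinv, h2, htv, htv]
          have h4 : t • (t * (t⁻¹ * y * t))⁻¹ • q = y⁻¹ • q := by
            rw [smul_smul]; congr 1; group
          rw [h4]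
          have h5 : ((1 : G) : G ⧸ C k) = y⁻¹ • q ↔ ((1 : G) : G ⧸ C k) = q := by
            rw [eq_inv_smul_iff]
            have : y • ((1 : G) : G ⧸ C k) = ((1 : G) : G ⧸ C k) := by
              change ((y * 1 : G) : G ⧸ C k) = ((1 : G) : G ⧸ C k)
              refine (QuotientGroup.eq.2 ?_).symm
              simpa using hyC
            rw [this]
          simp only [h5]
          omega
      | one => exact hone
      | mul a b _ _ ha hb => intro q; rw [hmul, ha, hb, add_zero]
      | inv a _ ha => intro q; rw [hinv, ha, neg_zero]
  refine ⟨k, δ, hmul, ?_, ?_, hBz (k + 1) le_rfl⟩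
  · intro q
    rw [htv]
    by_cases h : ((1 : G) : G ⧸ C k) = q
    · simp only [h, if_true, ne_eq, one_ne_zero, not_false_eq_true, true_iff]; exact h.symm
    · simp only [h, if_false, ne_eq, not_true_eq_false, false_iff]
      exact fun h' => h h'.symm
  · rw [htv]; exact if_pos rfl
end Part2

section Part3
open scoped Pointwise

theorem EA.free_of_deriv {G : Type u} [Group G] (χ : G →* Multiplicative ℤ) (t : G)
    (ht : χ t = Multiplicative.ofAdd 1) (B C : Subgroup G) (hCB : C ≤ B) (hCt : C ≤ EA.cj t B)
    (hB : B ≤ χ.ker) (hgen : Subgroup.closure ((B : Set G) ∪ {t}) = ⊤)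
    (δ : G → G ⧸ C → ℤ) (hmul : ∀ g h q, δ (g * h) q = δ g q + δ h (g⁻¹ • q))
    (ht0 : ∀ q, δ t q ≠ 0 ↔ q = ((1 : G) : G ⧸ C)) (ht1 : δ t ((1 : G) : G ⧸ C) = 1)
    (hBz : ∀ b ∈ B, ∀ q, δ b q = 0) (g : G) (hgB : g ∈ B) (hgC : g ∉ C)
    (hgD : t * g * t⁻¹ ∉ C) :
    Function.Injective (FreeGroup.lift (fun i : ULift.{u} Bool => if i.down then g * t * g⁻¹ else t)) := by
  classical
  have hone : ∀ q, δ 1 q = 0 := hBz 1 B.one_mem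
  have hinv : ∀ g q, δ g⁻¹ q = - δ g (g • q) := by
    intro g q
    have := hmul g⁻¹ g q
    rw [inv_mul_cancel, hone, inv_inv] at this
    omega
  have hlB : ∀ b ∈ B, ∀ h q, δ (b * h) q = δ h (b⁻¹ • q) := by
    intro b hb h q
    rw [hmul, hBz b hb, zero_add]
  have hsm : ∀ a b : G, a • ((b : G) : G ⧸ C) = ((a * b : G) : G ⧸ C) := fun a b => rfl
  -- the star of the base vertex
  let St : Set (G ⧸ C) := {q | ∃ b ∈ B, q = ((b : G) : G ⧸ C) ∨ q = ((b * t⁻¹ : G) : G ⧸ C)}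
  have hStar : ∀ h, h ∉ B → h * t ∉ B → ∀ q ∈ St, δ t (h⁻¹ • q) = 0 := by
    intro h h1 h2 q hq
    by_contra hne
    have hne := (ht0 _).1 hne
    rw [inv_smul_eq_iff, hsm, mul_one] at hne
    obtain ⟨b, hb, hq | hq⟩ := hq
    · rw [hq] at hne
      have := hCB (QuotientGroup.eq.1 hne)
      exact h1 ((Subgroup.mul_mem_cancel_left B (B.inv_mem hb)).1 this)
    · rw [hq] at hne
      have := hCt (QuotientGroup.eq.1 hne)
      rw [EA.mem_cj] at this
      have e : t⁻¹ * ((b * t⁻¹)⁻¹ * h) * t = b⁻¹ * (h * t) := by group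
      rw [e] at this
      exact h2 ((Subgroup.mul_mem_cancel_left B (B.inv_mem hb)).1 this)
  have hkey : ∀ h : G, ∀ q ∈ St, ∀ q' ∈ St, δ h q ≠ 0 → δ h q' ≠ 0 → q = q' := by
    intro h
    have hh : h ∈ Subgroup.closure ((B : Set G) ∪ {t}) := by rw [hgen]; trivial
    induction hh using Subgroup.closure_induction_right with
    | one => intro q _ q' _ h1; exact absurd (hone q) h1
    | mul_right h _ y hy ih =>
      rcases hy with hy | hy
      · intro q hq q' hq'
        rw [hmul, hmul, hBz y hy, hBz y hy, add_zero, add_zero]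
        exact ih q hq q' hq'
      · rw [Set.mem_singleton_iff.1 hy]
        by_cases h1 : h ∈ B
        · intro q hq q' hq'
          rw [hlB h h1, hlB h h1, ht0, ht0]
          intro e e'
          exact smul_left_cancel _ (e.trans e'.symm)
        by_cases h2 : h * t ∈ B
        · intro q _ q' _ h3
          exact absurd (hBz _ h2 q) h3
        intro q hq q' hq'
        rw [hmul, hmul, hStar h h1 h2 q hq, hStar h h1 h2 q' hq', add_zero, add_zero]
        exact ih q hq q' hq'
    | mul_inv_cancel h _ y hy ih =>
      rcases hy with hy | hy
      · intro q hq q' hq'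
        rw [hmul, hmul, hBz _ (B.inv_mem hy), hBz _ (B.inv_mem hy), add_zero, add_zero]
        exact ih q hq q' hq'
      · rw [Set.mem_singleton_iff.1 hy]
        have e : ∀ q, δ h q = δ (h * t⁻¹) q + δ t ((h * t⁻¹)⁻¹ • q) := by
          intro q
          rw [← hmul, inv_mul_cancel_right]
        by_cases h1 : h * t⁻¹ ∈ B
        · intro q _ q' _ h3
          exact absurd (hBz _ h1 q) h3
        by_cases h2 : h ∈ B
        · intro q hq q' hq' h3 h4
          have e1 := e q
          have e2 := e q'
          rw [hBz h h2] at e1 e2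
          have e3 := (ht0 ((h * t⁻¹)⁻¹ • q)).1 (by omega)
          have e4 := (ht0 ((h * t⁻¹)⁻¹ • q')).1 (by omega)
          exact smul_left_cancel _ (e3.trans e4.symm)
        intro q hq q' hq' h3 h4
        have e1 := e q
        have e2 := e q'
        rw [hStar _ h1 (by rwa [inv_mul_cancel_right]) q hq, add_zero] at e1
        rw [hStar _ h1 (by rwa [inv_mul_cancel_right]) q' hq', add_zero] at e2
        exact ih q hq q' hq' (by rwa [e1]) (by rwa [e2])
  let c : ULift.{u} Bool → G := fun i => if i.down then g else 1
  have hcB : ∀ i, c i ∈ B := by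
    intro i
    by_cases h : i.down = true
    · simp [c, h, hgB]
    · simp [c, h, B.one_mem]
  have hcases : ∀ i j, i ≠ j → (c i = 1 ∧ c j = g) ∨ (c i = g ∧ c j = 1) := by
    rintro ⟨_ | _⟩ ⟨_ | _⟩ h <;> simp [c] at h ⊢
  have hfun : (fun i : ULift.{u} Bool => if i.down then g * t * g⁻¹ else t) =
      fun i => c i * t * (c i)⁻¹ := by
    funext i
    by_cases h : i.down = true <;> simp [c, h]
  rw [hfun]
  let X : ULift.{u} Bool → Set G := fun i => {h | δ h ((c i : G) : G ⧸ C) ≠ 0}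
  let Y : ULift.{u} Bool → Set G := fun i => {h | δ h ((c i * t⁻¹ : G) : G ⧸ C) ≠ 0}
  have hXS : ∀ i, ((c i : G) : G ⧸ C) ∈ St := fun i => ⟨c i, hcB i, Or.inl rfl⟩
  have hYS : ∀ i, ((c i * t⁻¹ : G) : G ⧸ C) ∈ St := fun i => ⟨c i, hcB i, Or.inr rfl⟩
  refine FreeGroup.injective_lift_of_ping_pong _ X Y ?_ ?_ ?_ ?_ ?_ ?_
  · intro i
    refine ⟨c i * t, ?_⟩
    change δ _ _ ≠ 0
    rw [hlB _ (hcB i), hsm, inv_mul_cancel, ht1]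
    exact one_ne_zero
  · intro i j hij
    refine Set.disjoint_left.2 fun h h1 h2 => ?_
    have := QuotientGroup.eq.1 (hkey h _ (hXS i) _ (hXS j) h1 h2)
    rcases hcases i j hij with ⟨e1, e2⟩ | ⟨e1, e2⟩ <;> rw [e1, e2] at this <;> simp at this <;>
      exact hgC this
  · intro i j hij
    refine Set.disjoint_left.2 fun h h1 h2 => ?_
    have := QuotientGroup.eq.1 (hkey h _ (hYS i) _ (hYS j) h1 h2)
    rcases hcases i j hij with ⟨e1, e2⟩ | ⟨e1, e2⟩ <;> rw [e1, e2] at this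
    · apply hgD
      convert this using 1
      group
    · apply hgD
      rw [← C.inv_mem_iff]
      convert this using 1
      group
  · intro i j
    refine Set.disjoint_left.2 fun h h1 h2 => ?_
    have := hB (hCB (QuotientGroup.eq.1 (hkey h _ (hXS i) _ (hYS j) h1 h2)))
    have e1 := MonoidHom.mem_ker.1 (hB (hcB i))
    have e2 := MonoidHom.mem_ker.1 (hB (hcB j))
    rw [MonoidHom.mem_ker, map_mul, map_mul, map_inv, map_inv, e1, e2, ht] at this
    have := congrArg Multiplicative.toAdd this
    simp at this
  · rintro i _ ⟨h, hh, rfl⟩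
    have hh : δ h ((c i * t⁻¹ : G) : G ⧸ C) = 0 := not_not.1 hh
    change δ (c i * t * (c i)⁻¹ * h) _ ≠ 0
    rw [mul_assoc, mul_assoc, hlB _ (hcB i), hmul, hlB _ (B.inv_mem (hcB i)), hsm, hsm, hsm,
      inv_mul_cancel, ht1, inv_inv, mul_one, hh]
    norm_num
  · rintro i _ ⟨h, hh, rfl⟩
    have hh : δ h ((c i : G) : G ⧸ C) = 0 := not_not.1 hh
    change δ ((c i * t * (c i)⁻¹)⁻¹ * h) _ ≠ 0
    have e : (c i * t * (c i)⁻¹)⁻¹ * h = c i * (t⁻¹ * ((c i)⁻¹ * h)) := by group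
    rw [e, hlB _ (hcB i), hmul, hlB _ (B.inv_mem (hcB i)), hinv, hsm, hsm, hsm, hsm,
      inv_mul_cancel_left, mul_inv_cancel, ht1, inv_inv, inv_inv, mul_inv_cancel, mul_one, hh]
    norm_num
end Part3

section Part4

/-- virtually solvable -/
def EA.VS (G : Type u) [Group G] : Prop := ∃ H : Subgroup G, H.FiniteIndex ∧ Group.IsSolvable H

lemma EA.free_solvable_comm {F : Type u} [Group F] [IsFreeGroup F] [Group.IsSolvable F] (a b : F) :
    a * b = b * a := by
  classical
  let e := IsFreeGroup.mulEquiv F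
  by_cases hs : Subsingleton (IsFreeGroup.Generators F)
  · have key : ∀ x y : FreeGroup (IsFreeGroup.Generators F), x * y = y * x := by
      rcases isEmpty_or_nonempty (IsFreeGroup.Generators F) with h | ⟨⟨s⟩⟩
      · intro x y; exact Subsingleton.elim _ _
      · have hz : ∀ x : FreeGroup (IsFreeGroup.Generators F), ∃ n : ℤ, x = FreeGroup.of s ^ n := by
          intro x
          induction x using FreeGroup.induction_on with
          | C1 => exact ⟨0, by simp⟩
          | of x => exact ⟨1, by rw [zpow_one, Subsingleton.elim x s]⟩
          | inv_of x _ => exact ⟨-1, by rw [zpow_neg_one, Subsingleton.elim x s]⟩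
          | mul x y hx hy =>
            obtain ⟨n, rfl⟩ := hx
            obtain ⟨m, rfl⟩ := hy
            exact ⟨n + m, (zpow_add _ _ _).symm⟩
        intro x y
        obtain ⟨n, rfl⟩ := hz x
        obtain ⟨m, rfl⟩ := hz y
        rw [← zpow_add, ← zpow_add, add_comm]
    apply e.symm.injective
    rw [map_mul, map_mul, key]
  · exfalso
    rw [not_subsingleton_iff_nontrivial] at hs
    obtain ⟨p, q, hpq⟩ := hs
    let f : FreeGroup (IsFreeGroup.Generators F) →* Equiv.Perm (Fin 5) :=
      FreeGroup.lift (fun z => if z = p then finRotate 5 else Equiv.swap 0 (finRotate 5 0))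
    have hf : Function.Surjective f := by
      rw [← MonoidHom.range_eq_top, eq_top_iff,
        ← Equiv.Perm.closure_cycle_adjacent_swap (σ := finRotate 5) isCycle_finRotate
          support_finRotate 0, Subgroup.closure_le]
      rintro z (rfl | rfl)
      · exact ⟨FreeGroup.of p, by simp [f]⟩
      · exact ⟨FreeGroup.of q, by simp only [f, FreeGroup.lift_apply_of]; rw [if_neg (Ne.symm hpq)]⟩
    have h2 : Function.Surjective (f.comp e.symm.toMonoidHom) := hf.comp e.symm.surjective
    exact Equiv.Perm.not_isSolvable_fin_5 (Group.isSolvable_of_surjective h2)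

lemma EA.no_free {G : Type u} [Group G] (χ : G →* Multiplicative ℤ)
    (hK : ∀ K : Subgroup G, K ≤ χ.ker → K.FG → EA.VS K)
    (f : FreeGroup (ULift.{u} Bool) →* G) (hf : Function.Injective f)
    (hχ : χ (f (FreeGroup.of ⟨true⟩)) = χ (f (FreeGroup.of ⟨false⟩))) : False := by
  classical
  let x : FreeGroup (ULift.{u} Bool) := FreeGroup.of ⟨false⟩
  let y : FreeGroup (ULift.{u} Bool) := FreeGroup.of ⟨true⟩
  let w : FreeGroup (ULift.{u} Bool) := y * x⁻¹
  let z : FreeGroup (ULift.{u} Bool) := x * w * x⁻¹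
  have hw : χ (f w) = 1 := by
    simp only [w, map_mul, map_inv]
    rw [mul_inv_eq_one]
    exact hχ
  have hz : χ (f z) = 1 := by
    simp only [z, map_mul, map_inv, hw, mul_one, mul_inv_cancel]
  let K : Subgroup G := Subgroup.closure {f w, f z}
  have hKle : K ≤ χ.ker := by
    rw [Subgroup.closure_le]
    rintro _ (rfl | rfl)
    · exact hw
    · exact hz
  obtain ⟨S, hS1, hS2⟩ := hK K hKle ⟨{f w, f z}, by simp [K]⟩
  let T : Subgroup (FreeGroup (ULift.{u} Bool)) := (S.map K.subtype).comap f
  have hTS : Group.IsSolvable T := by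
    have : Group.IsSolvable (S.map K.subtype) :=
      Group.isSolvable_of_surjective (K.subtype.subgroupMap_surjective S)
    let j : T →* (S.map K.subtype) := f.subgroupComap _
    refine Group.isSolvable_of_isSolvable_injective (f := j) ?_
    intro a b hab
    have : f a = f b := congrArg Subtype.val hab
    exact Subtype.ext (hf this)
  have hpow : ∀ p : FreeGroup (ULift.{u} Bool), f p ∈ K → ∃ n : ℕ, 0 < n ∧ p ^ n ∈ T := by
    intro p hp
    obtain ⟨n, hn, -, h⟩ := Subgroup.exists_pow_mem_of_index_ne_zero hS1.index_ne_zero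
      (⟨f p, hp⟩ : K)
    refine ⟨n, hn, ?_⟩
    rw [Subgroup.mem_comap, map_pow]
    exact ⟨_, h, rfl⟩
  obtain ⟨m, hm, hwm⟩ := hpow w (Subgroup.subset_closure (by simp))
  obtain ⟨n, hn, hzn⟩ := hpow z (Subgroup.subset_closure (by simp))
  have hcomm : w ^ m * z ^ n = z ^ n * w ^ m :=
    congrArg Subtype.val (EA.free_solvable_comm (F := T) ⟨_, hwm⟩ ⟨_, hzn⟩)
  let φ : FreeGroup (ULift.{u} Bool) →* Matrix.SpecialLinearGroup (Fin 2) ℤ :=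
    FreeGroup.lift (fun i => if i.down then ModularGroup.T * ModularGroup.S else ModularGroup.S)
  have hφw : φ w = ModularGroup.T := by simp [φ, w, x, y]
  have hφz : φ z = ModularGroup.S * ModularGroup.T * ModularGroup.S⁻¹ := by
    simp only [z, map_mul, hφw, map_inv]
    simp [φ, x]
  have h2 := congrArg φ hcomm
  rw [map_mul, map_mul, map_pow, map_pow, hφw, hφz, conj_pow] at h2
  have hT : ∀ n : ℕ, ((ModularGroup.T ^ n : Matrix.SpecialLinearGroup (Fin 2) ℤ) :
      Matrix (Fin 2) (Fin 2) ℤ) = !![1, (n : ℤ); 0, 1] := by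
    intro n
    rw [← ModularGroup.coe_T_zpow, zpow_natCast]
  have h3 := congrArg (fun A : Matrix.SpecialLinearGroup (Fin 2) ℤ =>
    (A : Matrix (Fin 2) (Fin 2) ℤ) 0 0) h2
  have hS : ((ModularGroup.S : Matrix.SpecialLinearGroup (Fin 2) ℤ) :
      Matrix (Fin 2) (Fin 2) ℤ) = !![0, -1; 1, 0] := rfl
  have hS' : (((ModularGroup.S)⁻¹ : Matrix.SpecialLinearGroup (Fin 2) ℤ) :
      Matrix (Fin 2) (Fin 2) ℤ) = !![0, 1; -1, 0] := by
    rw [Matrix.SpecialLinearGroup.coe_inv, hS, Matrix.adjugate_fin_two]; simp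
  simp only [Matrix.SpecialLinearGroup.coe_mul, hT, hS, hS'] at h3
  simp [Matrix.mul_apply, Fin.sum_univ_two] at h3
  omega

end Part4

section Part5

lemma EA.finiteIndex_comap {G : Type u} {H : Type v} [Group G] [Group H] (f : G →* H)
    (S : Subgroup H) (hS : S.FiniteIndex) : (S.comap f).FiniteIndex := by
  refine ⟨?_⟩
  rw [Subgroup.index_comap]
  exact (Subgroup.instFiniteIndex_subgroupOf S f.range).index_ne_zero

lemma EA.VS.of_injective {G : Type u} {H : Type v} [Group G] [Group H] (f : G →* H)
    (hf : Function.Injective f) (h : EA.VS H) : EA.VS G := by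
  obtain ⟨S, hS1, hS2⟩ := h
  refine ⟨S.comap f, EA.finiteIndex_comap f S hS1, ?_⟩
  refine Group.isSolvable_of_isSolvable_injective (f := f.subgroupComap S) ?_
  intro a b hab
  exact Subtype.ext (hf (congrArg Subtype.val hab))

lemma EA.VS.of_finiteIndex {G : Type u} [Group G] (H : Subgroup G) (hH : H.FiniteIndex)
    (h : EA.VS H) : EA.VS G := by
  obtain ⟨S, hS1, hS2⟩ := h
  refine ⟨S.map H.subtype, ⟨?_⟩, Group.isSolvable_of_surjective (H.subtype.subgroupMap_surjective S)⟩
  rw [Subgroup.index_map_subtype]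
  exact mul_ne_zero hS1.index_ne_zero hH.index_ne_zero

lemma EA.VS.of_quotient {G : Type u} [Group G] (N : Subgroup G) [N.Normal] [Group.IsSolvable N]
    (h : EA.VS (G ⧸ N)) : EA.VS G := by
  obtain ⟨S, hS1, hS2⟩ := h
  have hle : N ≤ S.comap (QuotientGroup.mk' N) := by
    intro n hn
    rw [Subgroup.mem_comap, QuotientGroup.mk'_apply, (QuotientGroup.eq_one_iff n).2 hn]
    exact S.one_mem
  refine ⟨S.comap (QuotientGroup.mk' N), EA.finiteIndex_comap _ S hS1, ?_⟩
  refine Group.isSolvable_of_ker_le_range (Subgroup.inclusion hle)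
    ((QuotientGroup.mk' N).subgroupComap S) ?_
  rintro ⟨g, hg⟩ hk
  have : QuotientGroup.mk' N g = 1 := congrArg Subtype.val (MonoidHom.mem_ker.1 hk)
  exact ⟨⟨g, (QuotientGroup.eq_one_iff g).1 this⟩, rfl⟩

lemma EA.VS.of_finite_normal {G : Type u} [Group G] (N : Subgroup G) [N.Normal] [Finite N]
    (h : Group.IsSolvable (G ⧸ N)) : EA.VS G := by
  let Z := (MulAut.conjNormal : G →* MulAut N).ker
  have : Finite (MulAut N) := Finite.of_injective (fun e => (e : N → N)) DFunLike.coe_injective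
  refine ⟨Z, inferInstance, ?_⟩
  let g : Z →* G ⧸ N := (QuotientGroup.mk' N).comp Z.subtype
  have hc : ∀ a b : g.ker, a * b = b * a := by
    rintro ⟨⟨a, ha⟩, ha'⟩ ⟨⟨b, hb⟩, hb'⟩
    have hbN : b ∈ N := (QuotientGroup.eq_one_iff b).1 hb'
    have h1 : (MulAut.conjNormal a : MulAut N) = 1 := ha
    have h2 := congrArg Subtype.val (DFunLike.congr_fun h1 ⟨b, hbN⟩)
    simp only [MulAut.conjNormal_apply, MulAut.one_apply] at h2
    apply Subtype.ext
    apply Subtype.ext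
    exact mul_inv_eq_iff_eq_mul.1 h2
  have : Group.IsSolvable g.ker := Group.isSolvable_of_comm hc
  exact Group.isSolvable_of_ker_le_range g.ker.subtype g (by simp)

lemma EA.solvable_sup {B : Type u} [Group B] (S T : Subgroup B) [S.Normal]
    [Group.IsSolvable S] [Group.IsSolvable T] : Group.IsSolvable (S ⊔ T : Subgroup B) := by
  have h1 : Group.IsSolvable (T.map (QuotientGroup.mk' S)) :=
    Group.isSolvable_of_surjective ((QuotientGroup.mk' S).subgroupMap_surjective T)
  have h2 : (S ⊔ T).map (QuotientGroup.mk' S) = T.map (QuotientGroup.mk' S) := by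
    rw [Subgroup.map_sup, QuotientGroup.map_mk'_self, bot_sup_eq]
  rw [← h2] at h1
  refine Group.isSolvable_of_ker_le_range (Subgroup.inclusion (le_sup_left : S ≤ S ⊔ T))
    ((QuotientGroup.mk' S).subgroupMap (S ⊔ T)) ?_
  rintro ⟨g, hg⟩ hk
  have : QuotientGroup.mk' S g = 1 := congrArg Subtype.val (MonoidHom.mem_ker.1 hk)
  exact ⟨⟨g, (QuotientGroup.eq_one_iff g).1 this⟩, rfl⟩

lemma EA.exists_radical {B : Type u} [Group B] (h : EA.VS B) :
    ∃ S : Subgroup B, S.Normal ∧ S.FiniteIndex ∧ Group.IsSolvable S ∧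
      ∀ T : Subgroup B, T.Normal → Group.IsSolvable T → T ≤ S := by
  classical
  have hex : ∃ n : ℕ, ∃ S : Subgroup B, S.Normal ∧ S.FiniteIndex ∧ Group.IsSolvable S ∧
      S.index = n := by
    obtain ⟨H, h1, h2⟩ := h
    refine ⟨_, H.normalCore, inferInstance, inferInstance, ?_, rfl⟩
    exact Group.isSolvable_of_isSolvable_injective
      (Subgroup.inclusion_injective H.normalCore_le)
  obtain ⟨S, h1, h2, h3, h4⟩ := Nat.find_spec hex
  refine ⟨S, h1, h2, h3, fun T hT hT' => ?_⟩
  have hs : Group.IsSolvable (S ⊔ T : Subgroup B) := EA.solvable_sup S T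
  have hfi : (S ⊔ T).FiniteIndex := Subgroup.finiteIndex_of_le le_sup_left
  have hmin := Nat.find_min' hex ⟨S ⊔ T, inferInstance, hfi, hs, rfl⟩
  rw [← h4] at hmin
  have hmul := Subgroup.relIndex_mul_index (le_sup_left : S ≤ S ⊔ T)
  have hpos : 0 < (S ⊔ T).index := Nat.pos_of_ne_zero hfi.index_ne_zero
  have hle : S.relIndex (S ⊔ T) ≤ 1 := by
    by_contra hlt
    have : 2 * (S ⊔ T).index ≤ S.relIndex (S ⊔ T) * (S ⊔ T).index :=
      Nat.mul_le_mul_right _ (by omega)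
    omega
  have hne : S.relIndex (S ⊔ T) ≠ 0 := by
    intro h0
    rw [h0, zero_mul] at hmul
    exact h2.index_ne_zero hmul.symm
  have : S.relIndex (S ⊔ T) = 1 := by omega
  rw [Subgroup.relIndex_eq_one] at this
  exact le_sup_right.trans this

/-- derived series of a subgroup inside the ambient group -/
def EA.D {G : Type u} [Group G] (K : Subgroup G) : ℕ → Subgroup G
  | 0 => K
  | n + 1 => ⁅EA.D K n, EA.D K n⁆

lemma EA.D_eq {G : Type u} [Group G] (K : Subgroup G) (n : ℕ) :
    (derivedSeries K n).map K.subtype = EA.D K n := by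
  induction n with
  | zero => simp [EA.D, ← MonoidHom.range_eq_map]
  | succ n ih => rw [derivedSeries_succ, Subgroup.map_commutator, ih, EA.D]

lemma EA.D_map {G : Type u} {H : Type v} [Group G] [Group H] (f : G →* H) (K : Subgroup G) (n : ℕ) :
    EA.D (K.map f) n = (EA.D K n).map f := by
  induction n with
  | zero => rfl
  | succ n ih => rw [EA.D, EA.D, ih, Subgroup.map_commutator]

lemma EA.D_mono {G : Type u} [Group G] {K L : Subgroup G} (h : K ≤ L) (n : ℕ) :
    EA.D K n ≤ EA.D L n := by
  induction n with
  | zero => exact h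
  | succ n ih => exact Subgroup.commutator_mono ih ih

lemma EA.solvable_iff_D {G : Type u} [Group G] (K : Subgroup G) :
    Group.IsSolvable K ↔ ∃ n, EA.D K n = ⊥ := by
  rw [Group.isSolvable_def]
  refine exists_congr fun n => ?_
  rw [← EA.D_eq, Subgroup.map_eq_bot_iff_of_injective _ K.subtype_injective]

lemma EA.D_iSup {G : Type u} [Group G] (K : ℕ → Subgroup G) (hK : Monotone K) (n : ℕ) :
    EA.D (⨆ k, K k) n ≤ ⨆ k, EA.D (K k) n := by
  induction n with
  | zero => exact le_rfl
  | succ n ih =>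
    rw [EA.D, Subgroup.commutator_le]
    intro a ha b hb
    have hm : Monotone fun k => EA.D (K k) n := fun i j h => EA.D_mono (hK h) n
    obtain ⟨i, hi⟩ := (Subgroup.mem_iSup_of_directed hm.directed_le).1 (ih ha)
    obtain ⟨j, hj⟩ := (Subgroup.mem_iSup_of_directed hm.directed_le).1 (ih hb)
    refine (le_iSup (fun k => EA.D (K k) (n + 1)) (max i j)) ?_
    exact Subgroup.commutator_mem_commutator (hm (le_max_left i j) hi) (hm (le_max_right i j) hj)

theorem EA.VS_of_ascending {G : Type u} [Group G] (t : G) (B : Subgroup G) (hBt : B ≤ EA.cj t B)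
    (hgen : Subgroup.closure ((B : Set G) ∪ {t}) = ⊤) (hB : EA.VS B) : EA.VS G := by
  classical
  obtain ⟨S₀, hn, hfi, hsol, hmax⟩ := EA.exists_radical hB
  have hθm : ∀ b ∈ B, t⁻¹ * b * t ∈ B := fun b hb => (EA.mem_cj t B b).1 (hBt hb)
  let θ : B →* B :=
    { toFun := fun b => ⟨t⁻¹ * b.1 * t, hθm b.1 b.2⟩
      map_one' := by ext; simp
      map_mul' := fun a b => by ext; simp [mul_assoc] }
  have hθ : Function.Injective θ := by
    intro a b hab
    have : t⁻¹ * a.1 * t = t⁻¹ * b.1 * t := congrArg Subtype.val hab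
    exact Subtype.ext (mul_left_cancel (mul_right_cancel this))
  have hS1sol : Group.IsSolvable (S₀.comap θ) := by
    refine Group.isSolvable_of_isSolvable_injective (f := θ.subgroupComap S₀) ?_
    intro a b hab
    exact Subtype.ext (hθ (congrArg Subtype.val hab))
  have hS1le : S₀.comap θ ≤ S₀ := hmax _ inferInstance hS1sol
  have hidx : (S₀.comap θ).index ≤ S₀.index := by
    rw [Subgroup.index_comap]
    exact Nat.le_of_dvd (Nat.pos_of_ne_zero hfi.index_ne_zero) (Subgroup.relIndex_dvd_index_of_normal _ _)
  have hSle : S₀ ≤ S₀.comap θ := by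
    have hmul := Subgroup.relIndex_mul_index hS1le
    have hpos : 0 < S₀.index := Nat.pos_of_ne_zero hfi.index_ne_zero
    have hne : (S₀.comap θ).index ≠ 0 :=
      (EA.finiteIndex_comap θ S₀ hfi).index_ne_zero
    have h0 : (S₀.comap θ).relIndex S₀ ≠ 0 := by
      intro h0
      rw [h0, zero_mul] at hmul
      exact hne hmul.symm
    have h1 : (S₀.comap θ).relIndex S₀ ≤ 1 := by
      by_contra hlt
      have : 2 * S₀.index ≤ (S₀.comap θ).relIndex S₀ * S₀.index :=
        Nat.mul_le_mul_right _ (by omega)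
      omega
    exact Subgroup.relIndex_eq_one.1 (by omega)
  let S : Subgroup G := S₀.map B.subtype
  have hSB : S ≤ B := Subgroup.map_subtype_le _
  have hSt : ∀ s ∈ S, t⁻¹ * s * t ∈ S := by
    rintro _ ⟨s, hs, rfl⟩
    exact ⟨θ s, hSle hs, rfl⟩
  have hSn : ∀ b ∈ B, ∀ s ∈ S, b * s * b⁻¹ ∈ S := by
    rintro b hb _ ⟨s, hs, rfl⟩
    exact ⟨⟨b, hb⟩ * s * ⟨b, hb⟩⁻¹, hn.conj_mem s hs _, rfl⟩
  have hSsol : Group.IsSolvable S :=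
    Group.isSolvable_of_surjective (B.subtype.subgroupMap_surjective S₀)
  let K : ℕ → Subgroup G := fun k => EA.cj (t ^ k) S
  have hpow : ∀ (A : Subgroup G), (∀ a ∈ A, t⁻¹ * a * t ∈ A) → ∀ (k : ℕ), ∀ a ∈ A,
      (t ^ k)⁻¹ * a * t ^ k ∈ A := by
    intro A hA k
    induction k with
    | zero => intro a ha; simpa using ha
    | succ k ih =>
      intro a ha
      have := hA _ (ih a ha)
      convert this using 1
      rw [pow_succ]; group
  have hKmono : Monotone K := by
    refine monotone_nat_of_le_succ fun k g hg => ?_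
    rw [EA.mem_cj] at hg ⊢
    have := hSt _ hg
    convert this using 1
    rw [pow_succ]; group
  let R : Subgroup G := ⨆ k, K k
  have hRmem : ∀ r, r ∈ R ↔ ∃ k : ℕ, (t ^ k)⁻¹ * r * t ^ k ∈ S := by
    intro r
    rw [Subgroup.mem_iSup_of_directed hKmono.directed_le]
    exact exists_congr fun k => EA.mem_cj _ _ _
  have hRsol : Group.IsSolvable R := by
    obtain ⟨n, hn⟩ := (EA.solvable_iff_D S).1 hSsol
    rw [EA.solvable_iff_D]
    refine ⟨n, ?_⟩
    rw [eq_bot_iff]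
    refine (EA.D_iSup K hKmono n).trans (iSup_le fun k => ?_)
    have : EA.D (K k) n = (EA.D S n).map (MulAut.conj (t ^ k)).toMonoidHom := EA.D_map _ _ _
    rw [this, hn, Subgroup.map_bot]
  have hRn : R.Normal := by
    rw [← Subgroup.normalizer_eq_top_iff, eq_top_iff, ← hgen, Subgroup.closure_le]
    rintro g (hg | hg)
    · have aux : ∀ b ∈ B, ∀ r ∈ R, b * r * b⁻¹ ∈ R := by
        intro b hb r hr
        obtain ⟨k, hk⟩ := (hRmem r).1 hr
        refine (hRmem _).2 ⟨k, ?_⟩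
        have := hSn _ (hpow B hθm k b hb) _ hk
        convert this using 1
        group
      refine Subgroup.mem_normalizer_iff.2 fun r => ⟨aux g hg r, fun h => ?_⟩
      have := aux g⁻¹ (B.inv_mem hg) _ h
      convert this using 1
      group
    · rw [Set.mem_singleton_iff.1 hg]
      refine Subgroup.mem_normalizer_iff.2 fun r => ⟨fun h => ?_, fun h => ?_⟩
      · obtain ⟨k, hk⟩ := (hRmem r).1 h
        refine (hRmem _).2 ⟨k + 1, ?_⟩
        convert hk using 1
        rw [pow_succ']; group
      · obtain ⟨k, hk⟩ := (hRmem _).1 h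
        refine (hRmem _).2 ⟨k, ?_⟩
        have := hSt _ hk
        convert this using 1
        have e : t ^ k * t = t * t ^ k := (pow_succ t k).symm.trans (pow_succ' t k)
        calc (t ^ k)⁻¹ * r * t ^ k = (t * t ^ k)⁻¹ * (t * r * t⁻¹) * (t * t ^ k) := by group
          _ = (t ^ k * t)⁻¹ * (t * r * t⁻¹) * (t ^ k * t) := by rw [e]
          _ = t⁻¹ * ((t ^ k)⁻¹ * (t * r * t⁻¹) * t ^ k) * t := by group
  have hSR : S ≤ R := fun s hs => (hRmem s).2 ⟨0, by simpa using hs⟩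
  apply EA.VS.of_quotient R
  let π := QuotientGroup.mk' R
  let N : Subgroup (G ⧸ R) := B.map π
  have hNfin : Finite N := by
    let f : B →* G ⧸ R := π.comp B.subtype
    have hk : S₀ ≤ f.ker := by
      intro s hs
      exact (QuotientGroup.eq_one_iff s.1).2 (hSR ⟨s, hs, rfl⟩)
    have hkf : f.ker.FiniteIndex := Subgroup.finiteIndex_of_le hk
    have e : N = f.range := by
      rw [MonoidHom.range_comp, Subgroup.range_subtype]
    rw [e]
    have : Finite (B ⧸ f.ker) := inferInstance
    exact Finite.of_equiv _ (QuotientGroup.quotientKerEquivRange f).toEquiv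
  have hNt : EA.cj (π t) N = N := by
    have hle : N ≤ EA.cj (π t) N := by
      rintro _ ⟨b, hb, rfl⟩
      rw [EA.mem_cj]
      exact ⟨_, hθm b hb, by simp⟩
    have hfc : Finite (EA.cj (π t) N) := Finite.of_surjective _
      ((MulAut.conj (π t)).toMonoidHom.subgroupMap_surjective N)
    refine (Subgroup.eq_of_le_of_card_ge hle ?_).symm
    exact le_of_eq (Subgroup.card_map_of_injective (MulAut.conj (π t)).injective)
  have hgenQ : Subgroup.closure ((N : Set (G ⧸ R)) ∪ {π t}) = ⊤ := by
    have := congrArg (Subgroup.map π) hgen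
    rw [MonoidHom.map_closure, Set.image_union, Set.image_singleton,
      Subgroup.map_top_of_surjective π (QuotientGroup.mk'_surjective R)] at this
    exact this
  have hNn : N.Normal := by
    rw [← Subgroup.normalizer_eq_top_iff, eq_top_iff, ← hgenQ, Subgroup.closure_le]
    rintro g (hg | hg)
    · exact Subgroup.le_normalizer hg
    · rw [Set.mem_singleton_iff.1 hg]
      refine Subgroup.mem_normalizer_iff.2 fun r => ?_
      conv_rhs => rw [← hNt, EA.mem_cj]
      simp [mul_assoc]
  apply EA.VS.of_finite_normal N
  let τ : (G ⧸ R) ⧸ N := QuotientGroup.mk' N (π t)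
  have hz : ∀ q : (G ⧸ R) ⧸ N, q ∈ Subgroup.zpowers τ := by
    intro q
    obtain ⟨p, rfl⟩ := QuotientGroup.mk'_surjective N q
    have hp : p ∈ Subgroup.closure ((N : Set (G ⧸ R)) ∪ {π t}) := by rw [hgenQ]; trivial
    have hle : Subgroup.closure ((N : Set (G ⧸ R)) ∪ {π t}) ≤
        (Subgroup.zpowers τ).comap (QuotientGroup.mk' N) := by
      rw [Subgroup.closure_le]
      rintro g (hg | hg)
      · have : QuotientGroup.mk' N g = 1 := (QuotientGroup.eq_one_iff g).2 hg
        rw [SetLike.mem_coe, Subgroup.mem_comap, this]; exact Subgroup.one_mem _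
      · rw [Set.mem_singleton_iff.1 hg]
        exact Subgroup.mem_zpowers τ
    exact hle hp
  refine Group.isSolvable_of_comm fun a b => ?_
  obtain ⟨m, rfl⟩ := hz a
  obtain ⟨n, rfl⟩ := hz b
  change τ ^ m * τ ^ n = τ ^ n * τ ^ m
  rw [← zpow_add, ← zpow_add, add_comm]

end Part5
section Part6

lemma EA.fg_map {G : Type u} {H : Type v} [Group G] [Group H] (f : G →* H) {S : Subgroup G}
    (h : S.FG) : (S.map f).FG := by
  classical
  obtain ⟨s, hs⟩ := h
  exact ⟨s.image f, by rw [Finset.coe_image, ← MonoidHom.map_closure, hs]⟩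

lemma EA.BB_fg {G : Type u} [Group G] (t : G) (B : Subgroup G) (hB : B.FG) (k : ℕ) :
    (EA.BB t B k).FG := by
  induction k with
  | zero => exact hB
  | succ k ih =>
    rw [EA.BB]
    exact ih.sup (EA.fg_map _ ih)

lemma EA.le_or_le {G : Type u} [Group G] (B C D : Subgroup G)
    (h : ∀ g ∈ B, g ∈ C ∨ g ∈ D) : B ≤ C ∨ B ≤ D := by
  by_contra hcon
  rw [not_or] at hcon
  obtain ⟨⟨a, ha, ha'⟩, ⟨b, hb, hb'⟩⟩ := hcon.imp SetLike.not_le_iff_exists.1 SetLike.not_le_iff_exists.1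
  have haD := (h a ha).resolve_left ha'
  have hbC := (h b hb).resolve_right hb'
  rcases h (a * b) (B.mul_mem ha hb) with h1 | h1
  · exact ha' ((C.mul_mem_cancel_right hbC).1 h1)
  · exact hb' ((D.mul_mem_cancel_left haD).1 h1)

theorem EA.main_aux {G : Type u} [Group G] (hFP : Group.IsTypeFP2 G)
    (χ : G →* Multiplicative ℤ) {X : Type v} [Fintype X] (x : X → G)
    (hx : Subgroup.closure (Set.range x) = ⊤) (i₀ : X) (ht : χ (x i₀) = Multiplicative.ofAdd 1)
    (hker : ∀ i, i ≠ i₀ → x i ∈ χ.ker)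
    (hK : ∀ K : Subgroup G, K ≤ χ.ker → K.FG → EA.VS K) : EA.VS G := by
  classical
  obtain ⟨B₀, hB₀⟩ : ∃ B₀, B₀ = Subgroup.closure (x '' {i | i ≠ i₀}) := ⟨_, rfl⟩
  have hB₀k : B₀ ≤ χ.ker := by
    rw [hB₀, Subgroup.closure_le]
    rintro _ ⟨i, hi, rfl⟩
    exact hker i hi
  have hB₀fg : B₀.FG := by
    rw [hB₀]
    exact (Subgroup.fg_iff _).2 ⟨_, rfl, Set.toFinite _⟩
  obtain ⟨k, δ, hmul, ht0, ht1, hBz⟩ := EA.exists_deriv hFP χ x hx i₀ ht B₀ hB₀ hB₀k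
  have hgen : Subgroup.closure ((EA.BB (x i₀) B₀ (k + 1) : Set G) ∪ {x i₀}) = ⊤ := by
    rw [eq_top_iff, ← hx, Subgroup.closure_le]
    rintro _ ⟨i, rfl⟩
    apply Subgroup.subset_closure
    by_cases hi : i = i₀
    · right; rw [hi]; rfl
    · left
      refine EA.BB_mono (x i₀) B₀ (Nat.zero_le (k + 1)) ?_
      change x i ∈ B₀
      rw [hB₀]
      exact Subgroup.subset_closure ⟨i, hi, rfl⟩
  generalize x i₀ = t at *
  have hBk : EA.BB t B₀ (k + 1) ≤ χ.ker := EA.BB_le_ker χ t B₀ hB₀k _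
  have hVS : EA.VS (EA.BB t B₀ (k + 1)) := hK _ hBk (EA.BB_fg t B₀ hB₀fg _)
  have hle : EA.BB t B₀ k ≤ EA.BB t B₀ (k + 1) := EA.BB_mono t B₀ (Nat.le_succ k)
  have hcov : ∀ g ∈ EA.BB t B₀ (k + 1), g ∈ EA.cj t (EA.BB t B₀ k) ∨ g ∈ EA.BB t B₀ k := by
    intro g hg
    by_contra hcon
    rw [not_or] at hcon
    have hgD : t * g * t⁻¹ ∉ EA.cj t (EA.BB t B₀ k) := by
      rw [EA.mem_cj]
      have e : t⁻¹ * (t * g * t⁻¹) * t = g := by group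
      rw [e]; exact hcon.2
    have hinj := EA.free_of_deriv χ t ht _ _ (EA.BB_cj_le t B₀ k) (EA.cj_mono t hle) hBk hgen δ
      hmul ht0 ht1 hBz g hg hcon.1 hgD
    refine EA.no_free χ hK _ hinj ?_
    simp [mul_comm]
  rcases EA.le_or_le _ _ _ hcov with h | h
  · exact EA.VS_of_ascending t _ (h.trans (EA.cj_mono t hle)) hgen hVS
  · refine EA.VS_of_ascending t⁻¹ (EA.BB t B₀ (k + 1)) ?_ ?_ hVS
    · intro g hg
      rw [EA.mem_cj]
      have : t * g * t⁻¹ ∈ EA.cj t (EA.BB t B₀ k) := by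
        rw [EA.mem_cj]
        have e : t⁻¹ * (t * g * t⁻¹) * t = g := by group
        rw [e]; exact h hg
      rw [inv_inv]
      exact EA.BB_cj_le t B₀ k this
    · rw [eq_top_iff, ← hgen, Subgroup.closure_le]
      rintro g (hg | hg)
      · exact Subgroup.subset_closure (Or.inl hg)
      · rw [Set.mem_singleton_iff.1 hg]
        rw [SetLike.mem_coe, ← Subgroup.inv_mem_iff]
        exact Subgroup.subset_closure (Or.inr rfl)

theorem EA.main_Z {G : Type u} [Group G] (hFP : Group.IsTypeFP2 G) (hfg : Group.FG G)
    (χ : G →* Multiplicative ℤ) (hχ : Function.Surjective χ)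
    (hK : ∀ K : Subgroup G, K ≤ χ.ker → K.FG → EA.VS K) : EA.VS G := by
  classical
  obtain ⟨t, ht⟩ := hχ (Multiplicative.ofAdd 1)
  obtain ⟨s, hs⟩ := hfg.out
  let x : Option s → G := fun o => o.elim t fun a => a.1 * t ^ (-(Multiplicative.toAdd (χ a.1)))
  refine EA.main_aux hFP χ x ?_ none ht ?_ hK
  · rw [eq_top_iff, ← hs, Subgroup.closure_le]
    intro a ha
    have h1 : t ∈ Subgroup.closure (Set.range x) := Subgroup.subset_closure ⟨none, rfl⟩
    have h2 : a * t ^ (-(Multiplicative.toAdd (χ a))) ∈ Subgroup.closure (Set.range x) :=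
      Subgroup.subset_closure ⟨some ⟨a, ha⟩, rfl⟩
    exact (Subgroup.mul_mem_cancel_right _ (Subgroup.zpow_mem _ h1 _)).1 h2
  · rintro (_ | a) ha
    · exact absurd rfl ha
    · change χ (a.1 * t ^ (-(Multiplicative.toAdd (χ a.1)))) = 1
      rw [map_mul, map_zpow, ht, ← ofAdd_zsmul]
      simp

/-- every finitely generated subgroup is virtually solvable -/
def EA.LV {G : Type u} [Group G] (M : Subgroup G) : Prop :=
  ∀ K : Subgroup G, K ≤ M → K.FG → EA.VS K

/-- the induction property -/
def EA.P (G : Type u) [Group G] (Q : Type u) [Group Q] : Prop :=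
  ∀ (E : Subgroup G) (π : E →* Q), EA.LV (π.ker.map E.subtype) → EA.LV E

lemma EA.LV.sub {G : Type u} [Group G] {Q : Type v} [Group Q] {E : Subgroup G} {π : E →* Q}
    (h : EA.LV (π.ker.map E.subtype)) {L : Subgroup E} (hL : L ≤ π.ker) (hfg : L.FG) :
    EA.VS L := by
  have := h (L.map E.subtype) (Subgroup.map_mono hL) (EA.fg_map _ hfg)
  exact EA.VS.of_injective (L.equivMapOfInjective E.subtype E.subtype_injective).toMonoidHom
    (L.equivMapOfInjective E.subtype E.subtype_injective).injective this

lemma EA.LV.mono {G : Type u} [Group G] {M N : Subgroup G} (h : M ≤ N) (hN : EA.LV N) :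
    EA.LV M := fun K hK => hN K (hK.trans h)

lemma EA.P_of {G : Type u} [Group G] {Q : Type u} [Group Q]
    (h : ∀ (E : Subgroup G) (π : E →* Q), E.FG → EA.LV (π.ker.map E.subtype) → EA.VS E) :
    EA.P G Q := by
  intro E π hπ K hK hfg
  refine h K (π.comp (Subgroup.inclusion hK)) hfg (EA.LV.mono ?_ hπ)
  rintro _ ⟨a, ha, rfl⟩
  exact ⟨⟨a.1, hK a.2⟩, ha, rfl⟩

lemma EA.LV.of_finite_range {G : Type u} [Group G] {Q : Type v} [Group Q] {E : Subgroup G}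
    {π : E →* Q} (hfg : E.FG) (hfin : Finite π.range) (h : EA.LV (π.ker.map E.subtype)) :
    EA.VS E := by
  have hFG : Group.FG E := (Group.fg_iff_subgroup_fg E).2 hfg
  have hfi : π.ker.FiniteIndex := inferInstance
  refine EA.VS.of_finiteIndex π.ker hfi (h.sub le_rfl ?_)
  exact (Group.fg_iff_subgroup_fg _).1 (Subgroup.fg_of_index_ne_zero π.ker)

lemma EA.P_finite {G : Type u} [Group G] {Q : Type u} [Group Q] (hQ : Finite Q) : EA.P G Q :=
  EA.P_of fun _ _ hfg h => h.of_finite_range hfg inferInstance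

lemma EA.P_inj {G : Type u} [Group G] {Q R : Type u} [Group Q] [Group R] (f : Q →* R)
    (hf : Function.Injective f) (h : EA.P G R) : EA.P G Q := by
  intro E π hπ
  refine h E (f.comp π) (EA.LV.mono (Subgroup.map_mono ?_) hπ)
  intro a ha
  exact hf ((MonoidHom.mem_ker.1 ha).trans f.map_one.symm)

lemma EA.P_ext {G : Type u} [Group G] {Q R : Type u} [Group Q] [Group R] (f : Q →* R)
    (h1 : EA.P G f.ker) (h2 : EA.P G R) : EA.P G Q := by
  intro E π hπ
  refine h2 E (f.comp π) ?_
  have hle : (f.comp π).ker.map E.subtype ≤ E := Subgroup.map_subtype_le _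
  refine h1 _ ((π.comp (Subgroup.inclusion hle)).codRestrict f.ker ?_) (EA.LV.mono ?_ hπ)
  · rintro ⟨_, a, ha, rfl⟩
    exact ha
  · rintro _ ⟨a, ha, rfl⟩
    exact ⟨⟨a.1, hle a.2⟩, congrArg Subtype.val (MonoidHom.mem_ker.1 ha), rfl⟩

lemma EA.P_union {G : Type u} [Group G] {Q : Type u} [Group Q] {ι : Type v} (S : ι → Subgroup Q)
    (hdir : Directed (· ≤ ·) S) (hcov : ∀ g, ∃ i, g ∈ S i) (h : ∀ i, EA.P G (S i)) :
    EA.P G Q := by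
  classical
  refine EA.P_of fun E π hfg hπ => ?_
  obtain ⟨T, hT⟩ := ((Group.fg_iff_subgroup_fg E).2 hfg).out
  choose j hj using hcov
  have : Nonempty ι := ⟨j 1⟩
  obtain ⟨i, hi⟩ := hdir.finset_le (T.image fun a => j (π a))
  have hr : ∀ a, π a ∈ S i := by
    have : (⊤ : Subgroup E) ≤ (S i).comap π := by
      rw [← hT, Subgroup.closure_le]
      intro a ha
      exact hi _ (Finset.mem_image_of_mem _ ha) (hj (π a))
    exact fun a => this trivial
  refine h i E (π.codRestrict (S i) hr) (EA.LV.mono (Subgroup.map_mono ?_) hπ) E le_rfl hfg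
  intro a ha
  exact congrArg Subtype.val (MonoidHom.mem_ker.1 ha)

lemma EA.P_cyclic {G : Type u} [Group G] (hcoh : Group.IsHomologicallyCoherent G)
    {Q : Type u} [Group Q] [IsCyclic Q] : EA.P G Q := by
  refine EA.P_of fun E π hfg hπ => ?_
  have hFG : Group.FG E := (Group.fg_iff_subgroup_fg E).2 hfg
  rcases finite_or_infinite π.range with hfin | hinf
  · exact hπ.of_finite_range hfg hfin
  · have e : π.range ≃* Multiplicative ℤ := intCyclicMulEquiv.symm
    have hk : (e.toMonoidHom.comp π.rangeRestrict).ker = π.ker := by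
      ext a
      simp [MonoidHom.mem_ker, Subtype.ext_iff]
    refine EA.main_Z (hcoh E hFG) hFG (e.toMonoidHom.comp π.rangeRestrict)
      (e.surjective.comp π.rangeRestrict_surjective) ?_
    rw [hk]
    exact fun K hK hKfg => hπ.sub hK hKfg

lemma EA.P_comm {G : Type u} [Group G] (hcoh : Group.IsHomologicallyCoherent G)
    {Q : Type u} [Group Q] (hc : ∀ a b : Q, a * b = b * a) : EA.P G Q := by
  classical
  have hnorm : ∀ N : Subgroup Q, N.Normal := fun N =>
    ⟨fun n hn g => by rw [hc g n, mul_inv_cancel_right]; exact hn⟩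
  refine EA.P_union (fun s : Finset Q => Subgroup.closure (s : Set Q)) ?_ ?_ ?_
  · intro s t
    exact ⟨s ∪ t, Subgroup.closure_mono (by simp), Subgroup.closure_mono (by simp)⟩
  · exact fun g => ⟨{g}, Subgroup.subset_closure (by simp)⟩
  · intro s
    induction s using Finset.induction_on with
    | empty =>
      apply EA.P_finite
      rw [Finset.coe_empty, Subgroup.closure_empty]
      infer_instance
    | insert a s _ ih =>
      have hn := hnorm (Subgroup.closure (s : Set Q))
      let p := QuotientGroup.mk' (Subgroup.closure (s : Set Q))
      have hle : Subgroup.closure ((insert a s : Finset Q) : Set Q) ≤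
          (Subgroup.zpowers (p a)).comap p := by
        rw [Subgroup.closure_le]
        intro b hb
        rcases Finset.mem_insert.1 (Finset.mem_coe.1 hb) with rfl | hb
        · exact Subgroup.mem_zpowers _
        · have : p b = 1 := (QuotientGroup.eq_one_iff b).2 (Subgroup.subset_closure hb)
          rw [SetLike.mem_coe, Subgroup.mem_comap, this]
          exact Subgroup.one_mem _
      let f := (p.comp (Subgroup.closure ((insert a s : Finset Q) : Set Q)).subtype).codRestrict
        (Subgroup.zpowers (p a)) (fun b => hle b.2)
      refine EA.P_ext f ?_ (EA.P_cyclic hcoh)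
      refine EA.P_inj (((Subgroup.subtype _).comp f.ker.subtype).codRestrict
        (Subgroup.closure (s : Set Q)) ?_) ?_ ih
      · intro b
        have : p b.1.1 = 1 := congrArg Subtype.val (MonoidHom.mem_ker.1 b.2)
        exact (QuotientGroup.eq_one_iff _).1 this
      · intro b c hbc
        have h3 := Subtype.ext_iff.1 hbc
        exact Subtype.ext (Subtype.ext h3)

lemma EA.P_EA {G : Type u} [Group G] (hcoh : Group.IsHomologicallyCoherent G)
    (Q : Type u) [Group Q] (hQ : ElementaryAmenable Q) : EA.P G Q := by
  induction hQ with
  | of_finite Q h => exact EA.P_finite h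
  | of_comm Q h => exact EA.P_comm hcoh h
  | of_mulEquiv Q R e _ ih => exact EA.P_inj e.symm.toMonoidHom e.symm.injective ih
  | of_extension Q N hN _ _ ih1 ih2 =>
    refine EA.P_ext (QuotientGroup.mk' N) ?_ ih2
    rw [QuotientGroup.ker_mk']
    exact ih1
  | of_directedUnion Q ι S hdir hcov _ ih => exact EA.P_union S hdir hcov ih

end Part6

/-- Every finitely generated elementary amenable homologically coherent group is virtually
soluble. -/
theorem virtuallySolvable_of_homologicallyCoherent (G : Type u) [Group G]
    (hEA : ElementaryAmenable G) (hfg : Group.FG G)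
    (hcoh : Group.IsHomologicallyCoherent G) :
    ∃ H : Subgroup G, H.FiniteIndex ∧ IsSolvable H := by
  have hFG : (⊤ : Subgroup G).FG := hfg.out
  have h : EA.VS (⊤ : Subgroup G) := by
    refine EA.P_EA hcoh G hEA ⊤ (Subgroup.subtype ⊤) ?_ ⊤ le_rfl hFG
    intro K hK _
    have hb : K = ⊥ := by
      rw [eq_bot_iff]
      refine hK.trans ?_
      rw [Subgroup.ker_subtype, Subgroup.map_bot]
    rw [hb]
    exact ⟨⊤, inferInstance, inferInstance⟩
  exact EA.VS.of_finiteIndex ⊤ inferInstance h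
end

section
/- Every Noetherian elementary amenable group is virtually polycyclic. -/
universe u v

/-- A group is polycyclic if it has a subnormal series with cyclic factors; equivalently
(peeling off the top factor of the series), it is trivial or has a polycyclic normal
subgroup with cyclic quotient. -/
inductive IsPolycyclic : ∀ (G : Type u) [Group G], Prop
  | of_subsingleton (G : Type u) [Group G] (h : Subsingleton G) : IsPolycyclic G
  | step (G : Type u) [Group G] (N : Subgroup G) (hN : N.Normal)
      (h1 : IsPolycyclic N) (h2 : IsCyclic (G ⧸ N)) : IsPolycyclic G

/-- A group is virtually polycyclic if it has a polycyclic subgroup of finite index. -/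
def IsVirtuallyPolycyclic (G : Type u) [Group G] : Prop :=
  ∃ H : Subgroup G, H.FiniteIndex ∧ IsPolycyclic H

section Helpers


theorem Aux.poly_of_equiv {G : Type u} [Group G] (h : IsPolycyclic G) :
    ∀ (H : Type u) [Group H], (G ≃* H) → IsPolycyclic H := by
  induction h with
  | of_subsingleton G h =>
    intro H _ e
    exact IsPolycyclic.of_subsingleton H e.symm.toEquiv.subsingleton
  | step G N hN h1 h2 ih =>
    intro H _ e
    have hn : (N.map (e : G →* H)).Normal := hN.map _ e.surjective
    refine IsPolycyclic.step H (N.map (e : G →* H)) hn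
      (ih _ (e.subgroupMap N)) ?_
    exact isCyclic_of_surjective (QuotientGroup.congr N (N.map (e : G →* H)) e rfl)
      (QuotientGroup.congr N (N.map (e : G →* H)) e rfl).surjective

theorem Aux.solv_mono {G : Type u} [Group G] {A B : Subgroup G} (h : A ≤ B)
    (hB : Group.IsSolvable B) : Group.IsSolvable A :=
  Group.isSolvable_of_isSolvable_injective (Subgroup.inclusion_injective h)

theorem Aux.solv_hom {G : Type u} [Group G] {Q : Type u} [Group Q] (φ : G →* Q)
    (B : Subgroup G) (h1 : Group.IsSolvable (B ⊓ φ.ker : Subgroup G)) (h2 : Group.IsSolvable (B.map φ)) :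
    Group.IsSolvable B := by
  refine Group.isSolvable_of_ker_le_range
    (Subgroup.inclusion (inf_le_left : B ⊓ φ.ker ≤ B)) (φ.subgroupMap B) ?_
  intro x hx
  have : φ x = 1 := congrArg Subtype.val (MonoidHom.mem_ker.1 hx)
  exact ⟨⟨x, x.2, this⟩, rfl⟩

theorem Aux.solv_sup {G : Type u} [Group G] (A B : Subgroup G) [A.Normal]
    (hA : Group.IsSolvable A) (hB : Group.IsSolvable B) : Group.IsSolvable (A ⊔ B : Subgroup G) := by
  refine Aux.solv_hom (QuotientGroup.mk' A) _ ?_ ?_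
  · exact Aux.solv_mono (by rw [QuotientGroup.ker_mk']; exact inf_le_right) hA
  · have : (A ⊔ B).map (QuotientGroup.mk' A) = B.map (QuotientGroup.mk' A) := by
      rw [Subgroup.map_sup]
      simp
    rw [this]
    exact Group.isSolvable_of_surjective ((QuotientGroup.mk' A).subgroupMap_surjective B)

theorem Aux.wf {G : Type u} [Group G] (h : ∀ H : Subgroup G, H.FG) :
    WellFoundedGT (Subgroup G) := by
  rw [wellFoundedGT_iff_monotone_chain_condition]
  intro a
  obtain ⟨S, hS⟩ := h (⨆ n, a n)
  have hm : ∀ x : G, ∃ n, x ∈ S → x ∈ a n := by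
    intro x
    by_cases hx : x ∈ S
    · have h1 : x ∈ ⨆ n, a n := hS ▸ Subgroup.subset_closure hx
      obtain ⟨n, hn⟩ := (Subgroup.mem_iSup_of_directed a.monotone.directed_le).1 h1
      exact ⟨n, fun _ => hn⟩
    · exact ⟨0, fun h => absurd h hx⟩
  choose n hn using hm
  have hle : (⨆ n, a n) ≤ a (S.sup n) := by
    rw [← hS, Subgroup.closure_le]
    intro x hx
    exact a.monotone (Finset.le_sup hx) (hn x hx)
  exact ⟨S.sup n, fun m hmm => le_antisymm (a.monotone hmm) ((le_iSup (fun n => a n) m).trans hle)⟩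

theorem Aux.fi_comap {G H : Type u} [Group G] [Group H] (f : G →* H) (hf : Function.Surjective f)
    (K : Subgroup H) (hK : K.FiniteIndex) : (K.comap f).FiniteIndex := by
  rw [Subgroup.finiteIndex_iff, Subgroup.index_comap_of_surjective K hf]
  exact hK.index_ne_zero

theorem Aux.radical {G : Type u} [Group G] (hG : ∀ H : Subgroup G, H.FG)
    (H : Subgroup G) [H.FiniteIndex] (hH : Group.IsSolvable H) :
    ∃ R : Subgroup G, R.Characteristic ∧ R.FiniteIndex ∧ Group.IsSolvable R := by
  have := Aux.wf hG
  obtain ⟨R, ⟨hRn, hRs⟩, hmax⟩ := WellFounded.has_min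
    (r := ((· > ·) : Subgroup G → Subgroup G → Prop)) this.wf
    {R : Subgroup G | R.Normal ∧ Group.IsSolvable R} ⟨⊥, inferInstance, inferInstance⟩
  have key : ∀ B : Subgroup G, B.Normal → Group.IsSolvable B → B ≤ R := by
    intro B hBn hBs
    by_contra hc
    refine hmax (R ⊔ B) ⟨inferInstance, Aux.solv_sup R B hRs hBs⟩ ?_
    exact left_lt_sup.2 hc
  refine ⟨R, ?_, ?_, hRs⟩
  · rw [Subgroup.characteristic_iff_map_le]
    intro φ
    refine key _ (hRn.map _ φ.surjective) ?_
    exact Group.isSolvable_of_surjective (φ.toMonoidHom.subgroupMap_surjective R)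
  · have : H.normalCore ≤ R :=
      key _ inferInstance (Aux.solv_mono (Subgroup.normalCore_le H) hH)
    exact Subgroup.finiteIndex_of_le this

theorem Aux.ext {G : Type u} [Group G] (N : Subgroup G) [N.Normal] (hN : ∀ H : Subgroup N, H.FG)
    (h1 : ∃ H : Subgroup N, H.FiniteIndex ∧ Group.IsSolvable H)
    (h2 : ∃ H : Subgroup (G ⧸ N), H.FiniteIndex ∧ Group.IsSolvable H) :
    ∃ H : Subgroup G, H.FiniteIndex ∧ Group.IsSolvable H := by
  obtain ⟨H, hH, hHs⟩ := h1
  obtain ⟨M, hM, hMs⟩ := h2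
  obtain ⟨R, hRc, hRf, hRs⟩ := Aux.radical hN H hHs
  set K : Subgroup G := R.map N.subtype with hK
  have hKn : K.Normal := inferInstance
  have hKs : Group.IsSolvable K := Group.isSolvable_of_surjective (N.subtype.subgroupMap_surjective R)
  let F : Subgroup (G ⧸ K) := N.map (QuotientGroup.mk' K)
  have hFn : F.Normal := Subgroup.Normal.map inferInstance _ (QuotientGroup.mk'_surjective K)
  have hF : Finite F := by
    let f : N →* F := (QuotientGroup.mk' K).subgroupMap N
    have hf : Function.Surjective f := (QuotientGroup.mk' K).subgroupMap_surjective N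
    have hle : R ≤ f.ker := by
      intro x hx
      rw [MonoidHom.mem_ker]
      apply Subtype.ext
      exact (QuotientGroup.eq_one_iff (x : G)).2 ⟨x, hx, rfl⟩
    have : f.ker.FiniteIndex := Subgroup.finiteIndex_of_le hle
    exact Finite.of_equiv _ (QuotientGroup.quotientKerEquivOfSurjective f hf).toEquiv
  have hAut : Finite (MulAut F) := Finite.of_injective (fun e : MulAut F => (e : F → F))
    DFunLike.coe_injective
  let c : G →* MulAut F := (MulAut.conjNormal : G ⧸ K →* MulAut F).comp (QuotientGroup.mk' K)
  have hC : c.ker.FiniteIndex := inferInstance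
  have hCN : Group.IsSolvable (c.ker ⊓ N : Subgroup G) := by
    refine Aux.solv_hom (QuotientGroup.mk' K) _ ?_ ?_
    · exact Aux.solv_mono (by rw [QuotientGroup.ker_mk']; exact inf_le_right) hKs
    · apply Group.isSolvable_of_comm
      rintro ⟨_, x, ⟨hx, -⟩, rfl⟩ ⟨_, y, ⟨-, hy⟩, rfl⟩
      apply Subtype.ext
      have h3 : c x ⟨QuotientGroup.mk' K y, y, hy, rfl⟩ = ⟨QuotientGroup.mk' K y, y, hy, rfl⟩ := by
        rw [MonoidHom.mem_ker.1 hx]; rfl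
      have h4 := congrArg Subtype.val h3
      exact mul_inv_eq_iff_eq_mul.1 h4
  have hM2 := Aux.fi_comap (QuotientGroup.mk' N) (QuotientGroup.mk'_surjective N) M hM
  refine ⟨c.ker ⊓ M.comap (QuotientGroup.mk' N), inferInstance, ?_⟩
  refine Aux.solv_hom (QuotientGroup.mk' N) _ ?_ ?_
  · refine Aux.solv_mono ?_ hCN
    rw [QuotientGroup.ker_mk']
    exact inf_le_inf_right _ inf_le_left
  · refine Aux.solv_mono ?_ hMs
    rw [Subgroup.map_le_iff_le_comap]
    exact inf_le_right

theorem Aux.fg_map {G H : Type u} [Group G] [Group H] (f : G →* H) (hf : Function.Surjective f)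
    (h : ∀ K : Subgroup G, K.FG) (K : Subgroup H) : K.FG := by
  rw [← Subgroup.map_comap_eq_self_of_surjective hf K]
  have h1 := h (K.comap f)
  rw [← Group.fg_iff_subgroup_fg] at h1 ⊢
  exact Group.fg_of_surjective (f.subgroupMap_surjective (K.comap f))

theorem Aux.fg_sub {G : Type u} [Group G] (N : Subgroup G)
    (h : ∀ K : Subgroup G, K.FG) (K : Subgroup N) : K.FG := by
  have h1 := h (K.map N.subtype)
  rw [← Group.fg_iff_subgroup_fg] at h1 ⊢
  exact Group.fg_of_surjective
    (f := (K.equivMapOfInjective N.subtype N.subtype_injective).symm.toMonoidHom)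
    (K.equivMapOfInjective N.subtype N.subtype_injective).symm.surjective

theorem Aux.vsolv (G : Type u) [Group G] (hEA : ElementaryAmenable G) :
    (∀ H : Subgroup G, H.FG) → ∃ H : Subgroup G, H.FiniteIndex ∧ Group.IsSolvable H := by
  induction hEA with
  | of_finite G h => exact fun _ => ⟨⊥, inferInstance, inferInstance⟩
  | of_comm G h =>
    intro _
    have := Group.isSolvable_of_comm h
    exact ⟨⊤, inferInstance, inferInstance⟩
  | of_mulEquiv G H e h ih =>
    intro hF
    obtain ⟨K, hK, hs⟩ := ih (Aux.fg_map (e.symm : H →* G) e.symm.surjective hF)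
    refine ⟨K.comap (e.symm : H →* G), Aux.fi_comap _ e.symm.surjective K hK, ?_⟩
    refine Group.isSolvable_of_isSolvable_injective (f := (e.symm : H →* G).subgroupComap K) ?_
    intro x y hxy
    exact Subtype.ext (e.symm.injective (congrArg Subtype.val hxy))
  | of_extension G N hN h1 h2 ih1 ih2 =>
    intro hF
    exact Aux.ext N (Aux.fg_sub N hF) (ih1 (Aux.fg_sub N hF))
      (ih2 (Aux.fg_map (QuotientGroup.mk' N) (QuotientGroup.mk'_surjective N) hF))
  | of_directedUnion G ι S hdir hcov h ih =>
    intro hF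
    classical
    have : Nonempty ι := (hcov 1).nonempty
    obtain ⟨s, hs⟩ := hF ⊤
    choose i hi using hcov
    obtain ⟨j, hj⟩ := hdir.finset_le (s.image i)
    have hj' : S j = ⊤ := by
      rw [eq_top_iff, ← hs, Subgroup.closure_le]
      intro x hx
      exact hj (i x) (Finset.mem_image_of_mem i hx) (hi x)
    obtain ⟨K, hK, hKs⟩ := ih j (Aux.fg_sub _ hF)
    refine ⟨K.map (S j).subtype, ?_,
      Group.isSolvable_of_surjective ((S j).subtype.subgroupMap_surjective K)⟩
    rw [Subgroup.finiteIndex_iff, Subgroup.index_map_subtype]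
    refine mul_ne_zero hK.index_ne_zero ?_
    rw [hj']
    simp

theorem Aux.step {G : Type u} [Group G] (A B : Subgroup G) (hAB : A ≤ B) (hc : ⁅B, B⁆ ≤ A)
    (hA : IsPolycyclic A) (b : G) (hb : b ∈ B) :
    IsPolycyclic (A ⊔ Subgroup.zpowers b : Subgroup G) := by
  set A2 := A ⊔ Subgroup.zpowers b with hA2
  have hle : A2 ≤ B := sup_le hAB (by simpa using hb)
  have hn : (A.subgroupOf A2).Normal := by
    constructor
    rintro ⟨n, hn2⟩ hn ⟨g, hg⟩
    have h1 : g * n * g⁻¹ * n⁻¹ ∈ A :=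
      hc (Subgroup.commutator_mem_commutator (hle hg) (hle hn2))
    have h2 := A.mul_mem h1 (Subgroup.mem_subgroupOf.1 hn)
    rw [Subgroup.mem_subgroupOf]
    simpa using h2
  refine IsPolycyclic.step _ (A.subgroupOf A2) hn
    (Aux.poly_of_equiv hA _ (Subgroup.subgroupOfEquivOfLe le_sup_left).symm) ?_
  have hbm : b ∈ A2 := Subgroup.mem_sup_right (Subgroup.mem_zpowers b)
  let β : A2 ⧸ A.subgroupOf A2 := QuotientGroup.mk' (A.subgroupOf A2) ⟨b, hbm⟩
  refine ⟨β, ?_⟩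
  have key : A2 ≤ ((Subgroup.zpowers β).comap (QuotientGroup.mk' (A.subgroupOf A2))).map
      A2.subtype := by
    refine sup_le ?_ ?_
    · intro a ha
      refine ⟨⟨a, Subgroup.mem_sup_left ha⟩, ?_, rfl⟩
      have : QuotientGroup.mk' (A.subgroupOf A2) ⟨a, Subgroup.mem_sup_left ha⟩ = 1 :=
        (QuotientGroup.eq_one_iff _).2 (Subgroup.mem_subgroupOf.2 ha)
      show QuotientGroup.mk' (A.subgroupOf A2) ⟨a, Subgroup.mem_sup_left ha⟩ ∈ Subgroup.zpowers β
      rw [this]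
      exact one_mem _
    · rw [Subgroup.zpowers_le]
      exact ⟨⟨b, hbm⟩, Subgroup.mem_zpowers β, rfl⟩
  intro x
  obtain ⟨y, rfl⟩ := QuotientGroup.mk'_surjective _ x
  obtain ⟨z, hz, hzy⟩ := key y.2
  have : z = y := Subtype.ext hzy
  subst this
  exact hz

theorem Aux.poly_up {G : Type u} [Group G] (A B : Subgroup G) (hAB : A ≤ B) (hc : ⁅B, B⁆ ≤ A)
    (hA : IsPolycyclic A) (hB : B.FG) : IsPolycyclic B := by
  classical
  obtain ⟨s, hs⟩ := hB
  have key : ∀ t : Finset G, (t : Set G) ⊆ B →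
      IsPolycyclic (A ⊔ Subgroup.closure (t : Set G) : Subgroup G) := by
    intro t
    induction t using Finset.induction_on with
    | empty =>
      intro _
      have : A ⊔ Subgroup.closure ((∅ : Finset G) : Set G) = A := by simp
      rw [this]
      exact hA
    | insert b t hbt ih =>
      intro ht
      rw [Finset.coe_insert, Set.insert_subset_iff] at ht
      have h1 := Aux.step _ B (sup_le hAB ((Subgroup.closure_le B).2 ht.2))
        (hc.trans le_sup_left) (ih ht.2) b ht.1
      have : A ⊔ Subgroup.closure ((insert b t : Finset G) : Set G)
          = A ⊔ Subgroup.closure (t : Set G) ⊔ Subgroup.zpowers b := by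
        rw [Finset.coe_insert, Set.insert_eq, Subgroup.closure_union,
          ← Subgroup.zpowers_eq_closure, sup_assoc, sup_comm (Subgroup.zpowers b)]
      rw [this]
      exact h1
  have h2 := key s (by rw [← hs]; exact Subgroup.subset_closure)
  rw [hs, sup_eq_right.2 hAB] at h2
  exact h2

theorem Aux.poly_of_solv (G : Type u) [Group G] (hs : Group.IsSolvable G) (h : ∀ H : Subgroup G, H.FG) :
    IsPolycyclic G := by
  obtain ⟨n, hn⟩ := hs
  have key : ∀ k ≤ n, IsPolycyclic (derivedSeries G (n - k)) := by
    intro k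
    induction k with
    | zero =>
      intro _
      rw [Nat.sub_zero, hn]
      exact IsPolycyclic.of_subsingleton _ inferInstance
    | succ k ih =>
      intro hk
      have h1 := ih (by omega)
      rw [show n - k = (n - (k + 1)) + 1 by omega] at h1
      exact Aux.poly_up _ _ (derivedSeries_antitone G (Nat.le_succ _)) le_rfl h1 (h _)
  have h0 := key n le_rfl
  rw [Nat.sub_self, derivedSeries_zero] at h0
  exact Aux.poly_of_equiv h0 G Subgroup.topEquiv

end Helpers

/-- Every Noetherian (slender) elementary amenable group is virtually polycyclic. -/
theorem virtuallyPolycyclic_of_noetherian (G : Type u) [Group G]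
    (hEA : ElementaryAmenable G) (hNoeth : ∀ H : Subgroup G, H.FG) :
    IsVirtuallyPolycyclic G := by
  obtain ⟨H, hH, hs⟩ := Aux.vsolv G hEA hNoeth
  exact ⟨H, hH, Aux.poly_of_solv H hs (Aux.fg_sub H hNoeth)⟩
end
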